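/- arXiv:2101.06496 — 3 statements merged into one kernel-verified Lean document; each statement's English description precedes it below -/
import Mathlib

section
/- Let K be a field, m ≤ n positive integers, X the m×n generic matrix over S = K[x_{ij}], and t an integer with 2 ≤ t ≤ m and t + 1 ≤ n. Then the following equality of ideals of S holds: I_t(X_{[1,t]}) + I_t(X_{[2,t+1]}) = I_t(X_{[1,t+1]}) ∩ I_{t−1}(X_{[2,t]}); moreover this is the minimal prime decomposition of the left-hand side, i.e. I_t(X_{[1,t+1]}) and I_{t−1}(X_{[2,t]}) are exactly the minimal primes of I_t(X_{[1,t]}) + I_t(X_{[2,t+1]}). -/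
/-- The ideal of `t × t` minors of the generic `m × n` matrix `X` (with entries
`X i j = MvPolynomial.X (i, j)`), using only rows with 1-based index in `[r1, r2]`
and columns with 1-based index in `[c1, c2]`. -/
noncomputable def genMinors (K : Type*) [Field K] (m n : ℕ) (t : ℕ) (r1 r2 c1 c2 : ℕ) :
    Ideal (MvPolynomial (Fin m × Fin n) K) :=
  Ideal.span { p | ∃ (r : Fin t → Fin m) (c : Fin t → Fin n),
    StrictMono r ∧ StrictMono c ∧
    (∀ i, r1 ≤ (r i).val + 1 ∧ (r i).val + 1 ≤ r2) ∧
    (∀ j, c1 ≤ (c j).val + 1 ∧ (c j).val + 1 ≤ c2) ∧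
    p = Matrix.det (Matrix.of fun i j => MvPolynomial.X (r i, c j)) }


namespace AdjMinors

/-- Lexicographic order on positions. -/
def rl {m n : ℕ} (p q : Fin m × Fin n) : Prop := p.1 < q.1 ∨ (p.1 = q.1 ∧ p.2 < q.2)

noncomputable def mo (m n : ℕ) : MonomialOrder (Fin m × Fin n) :=
  (MonomialOrder.lex : MonomialOrder (Lex (Fin m × Fin n)))

lemma mo_lt_iff {m n : ℕ} (a b : (Fin m × Fin n) →₀ ℕ) :
    (mo m n).toSyn a < (mo m n).toSyn b ↔
      ∃ p, (∀ q, rl q p → a q = b q) ∧ a p < b p := by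
  have h := @MonomialOrder.lex_lt_iff (Lex (Fin m × Fin n)) _ _ a b
  have h2 := @Finsupp.Lex.lt_iff (Lex (Fin m × Fin n)) ℕ _ _ _ (toLex a) (toLex b)
  refine h.trans (h2.trans ?_)
  constructor
  · rintro ⟨p, h1, h2⟩
    exact ⟨ofLex p, fun q hq => h1 (toLex q) (by rw [Prod.Lex.lt_iff]; exact hq), h2⟩
  · rintro ⟨p, h1, h2⟩
    exact ⟨toLex p, fun q hq => h1 (ofLex q) (by rw [Prod.Lex.lt_iff] at hq; exact hq), h2⟩

lemma groebner_span {σ K : Type*} [Field K] (M : MonomialOrder σ) (Q : Ideal (MvPolynomial σ K))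
    (G : Set (MvPolynomial σ K)) (hG : ∀ g ∈ G, M.leadingCoeff g = 1) (hGQ : ∀ g ∈ G, g ∈ Q)
    (h : ∀ f ∈ Q, f ≠ 0 → ∃ g ∈ G, M.degree g ≤ M.degree f) : Ideal.span G = Q := by
  apply le_antisymm
  · rw [Ideal.span_le]; exact hGQ
  · intro f hf
    obtain ⟨g, r, h1, -, h3⟩ := M.div_set (B := G) (fun b hb => by rw [hG b hb]; exact isUnit_one) f
    have hs : Finsupp.linearCombination _ (fun (b : G) ↦ (b : MvPolynomial σ K)) g ∈ Ideal.span G := by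
      rw [Finsupp.linearCombination_apply]
      apply Ideal.sum_mem
      intro i _
      exact Ideal.mul_mem_left _ _ (Ideal.subset_span i.2)
    have hle : Ideal.span G ≤ Q := by rw [Ideal.span_le]; exact hGQ
    have hr : r ∈ Q := by
      have : r = f - Finsupp.linearCombination _ (fun (b : G) ↦ (b : MvPolynomial σ K)) g := by
        rw [h1]; ring
      rw [this]; exact Ideal.sub_mem _ hf (hle hs)
    by_cases hr0 : r = 0
    · rw [h1, hr0, add_zero]; exact hs
    · obtain ⟨b, hb, hb2⟩ := h r hr hr0
      exact absurd hb2 (h3 _ (M.degree_mem_support hr0) b hb)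

/-- The exponent vector of a product along a permutation. -/
noncomputable def pm {m n t : ℕ} (r : Fin t → Fin m) (c : Fin t → Fin n) :
    (Fin m × Fin n) →₀ ℕ := ∑ i, Finsupp.single (r i, c i) 1

lemma pm_apply {m n t : ℕ} (r : Fin t → Fin m) (c : Fin t → Fin n) (p) :
    pm r c p = ∑ i, if (r i, c i) = p then 1 else 0 := by
  simp [pm, Finsupp.finsetSum_apply, Finsupp.single_apply]

lemma pm_lt {m n t : ℕ} (r : Fin t → Fin m) (c : Fin t → Fin n) (hr : StrictMono r)
    (hc : StrictMono c) (s : Equiv.Perm (Fin t)) (hs : s ≠ 1) :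
    (mo m n).toSyn (pm r (c ∘ s)) < (mo m n).toSyn (pm r c) := by
  rw [mo_lt_iff]
  have hex : ∃ i, s i ≠ i := by
    by_contra! h; exact hs (Equiv.ext h)
  obtain ⟨i0, hi0, hmin⟩ : ∃ i, s i ≠ i ∧ ∀ j, j < i → s j = j := by
    have hne : (Finset.univ.filter (fun i => s i ≠ i)).Nonempty := by
      obtain ⟨i, hi⟩ := hex; exact ⟨i, by simpa using hi⟩
    refine ⟨_, (Finset.mem_filter.1 (Finset.min'_mem _ hne)).2, ?_⟩
    intro j hj
    by_contra hcon
    have := Finset.min'_le (Finset.univ.filter (fun i => s i ≠ i)) j (by simpa using hcon)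
    exact absurd hj (not_lt.2 this)
  have hgt : i0 < s i0 := by
    rcases lt_trichotomy (s i0) i0 with h | h | h
    · exact absurd (s.injective (hmin _ h)) hi0
    · exact absurd h hi0
    · exact h
  refine ⟨(r i0, c i0), ?_, ?_⟩
  · rintro ⟨a, b⟩ hq
    rw [pm_apply, pm_apply]
    apply Finset.sum_congr rfl
    intro i _
    rcases lt_trichotomy i i0 with h | h | h
    · simp [hmin i h]
    · subst h
      have h1 : ¬ ((r i, (c ∘ s) i) = (a, b)) := by
        intro he
        simp only [Prod.mk.injEq, Function.comp] at he
        have := hc hgt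
        rcases hq with hq | ⟨_, hq⟩
        · simp only at hq; rw [he.1] at hq; exact lt_irrefl _ hq
        · simp only at hq; rw [← he.2] at hq; exact lt_asymm this hq
      have h2 : ¬ ((r i, c i) = (a, b)) := by
        intro he
        simp only [Prod.mk.injEq] at he
        rcases hq with hq | ⟨_, hq⟩
        · simp only at hq; rw [he.1] at hq; exact lt_irrefl _ hq
        · simp only at hq; rw [← he.2] at hq; exact lt_irrefl _ hq
      rw [if_neg h1, if_neg h2]
    · have h0 : r i ≠ a := by
        intro he
        have := hr h
        rcases hq with hq | ⟨hq, _⟩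
        · simp only at hq; rw [he] at this; exact lt_asymm this hq
        · simp only at hq; rw [he, hq] at this; exact lt_irrefl _ this
      simp [h0]
  · rw [pm_apply, pm_apply]
    have h1 : ∑ i, (if (r i, (c ∘ s) i) = (r i0, c i0) then 1 else 0) = 0 := by
      apply Finset.sum_eq_zero
      intro i _
      rw [if_neg]
      intro he
      simp only [Prod.mk.injEq, Function.comp] at he
      have := hr.injective he.1
      subst this
      exact hi0 (hc.injective he.2)
    rw [h1]
    apply Finset.sum_pos' (fun _ _ => by positivity)
    exact ⟨i0, Finset.mem_univ _, by simp⟩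

/-- A generic minor. -/
noncomputable def minor (K : Type*) [Field K] {m n t : ℕ} (r : Fin t → Fin m) (c : Fin t → Fin n) :
    MvPolynomial (Fin m × Fin n) K :=
  Matrix.det (Matrix.of fun i j => MvPolynomial.X (r i, c j))

lemma minor_eq (K : Type*) [Field K] {m n t : ℕ} (r : Fin t → Fin m) (c : Fin t → Fin n) :
    minor K r c = ∑ s : Equiv.Perm (Fin t),
      MvPolynomial.monomial (pm r (c ∘ s)) ((Equiv.Perm.sign s : ℤ) : K) := by
  unfold minor
  rw [← Matrix.det_transpose, Matrix.det_apply']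
  apply Finset.sum_congr rfl
  intro s _
  simp only [Matrix.transpose_apply, Matrix.of_apply, pm, Function.comp]
  rw [MvPolynomial.monomial_sum_index]
  simp [MvPolynomial.X]

lemma minor_degree (K : Type*) [Field K] {m n t : ℕ} (r : Fin t → Fin m) (c : Fin t → Fin n)
    (hr : StrictMono r) (hc : StrictMono c) :
    (mo m n).degree (minor K r c) = pm r c ∧ (mo m n).leadingCoeff (minor K r c) = 1 := by
  have hcoef : (minor K r c).coeff (pm r c) = 1 := by
    rw [minor_eq, MvPolynomial.coeff_sum, Finset.sum_eq_single 1]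
    · simp
    · intro s _ hs
      rw [MvPolynomial.coeff_monomial, if_neg]
      intro h
      have := pm_lt r c hr hc s hs
      rw [h] at this
      exact lt_irrefl _ this
    · simp
  have hdeg : (mo m n).degree (minor K r c) = pm r c := by
    apply (mo m n).toSyn.injective
    apply le_antisymm
    · rw [MonomialOrder.degree_le_iff]
      intro b hb
      rw [minor_eq] at hb
      obtain ⟨s, -, hs⟩ := Finset.mem_biUnion.1 (MvPolynomial.support_sum hb)
      have : b = pm r (c ∘ s) := by
        have := MvPolynomial.support_monomial_subset hs
        simpa using this
      rw [this]
      by_cases h1 : s = 1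
      · subst h1; exact le_rfl
      · exact (pm_lt r c hr hc s h1).le
    · apply MonomialOrder.le_degree
      rw [MvPolynomial.mem_support_iff, hcoef]; exact one_ne_zero
  exact ⟨hdeg, by rw [MonomialOrder.leadingCoeff, hdeg, hcoef]⟩

lemma pm_le {m n t : ℕ} (r : Fin t → Fin m) (c : Fin t → Fin n)
    (hr : StrictMono r) (μ : (Fin m × Fin n) →₀ ℕ) (h : ∀ i, μ (r i, c i) ≠ 0) :
    pm r c ≤ μ := by
  intro p
  rw [pm_apply]
  by_cases hp : ∃ i, (r i, c i) = p
  · obtain ⟨i, rfl⟩ := hp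
    rw [Finset.sum_eq_single i]
    · have := h i; simp; omega
    · intro j _ hj
      rw [if_neg]
      intro he
      exact hj (hr.injective (Prod.mk.inj he).1)
    · simp
  · push Not at hp
    rw [Finset.sum_eq_zero]
    · exact Nat.zero_le _
    · intro i _; rw [if_neg (hp i)]

lemma pm_ne {m n t : ℕ} (r : Fin t → Fin m) (c : Fin t → Fin n) (p) (h : pm r c p ≠ 0) :
    ∃ i, (r i, c i) = p := by
  rw [pm_apply] at h
  obtain ⟨i, _, hi⟩ := Finset.exists_ne_zero_of_sum_ne_zero h
  exact ⟨i, by by_contra hc; simp [hc] at hi⟩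

/-- weights -/
lemma exists_weight {σ : Type*} [Fintype σ] (r : σ → σ → Prop) [DecidableRel r]
    [IsTrans σ r] [Std.Irrefl r] (B : ℕ) :
    ∃ w : σ → ℕ, ∀ a, B * ∑ b, (if r a b then w b else 0) < w a := by
  have wf : WellFounded (Function.swap r) := Finite.wellFounded_of_trans_of_irrefl _
  let F : (a : σ) → ((b : σ) → Function.swap r b a → ℕ) → ℕ :=
    fun a ih => 1 + B * ∑ b, (if h : r a b then ih b h else 0)
  refine ⟨wf.fix F, fun a => ?_⟩
  conv_rhs => rw [wf.fix_eq]
  simp only [F, dite_eq_ite]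
  omega

lemma weight_lt {σ : Type*} [Fintype σ] [DecidableEq σ] (r : σ → σ → Prop) [DecidableRel r]
    (htri : ∀ a b, r a b ∨ a = b ∨ r b a) (hirr : ∀ a, ¬ r a a)
    (B : ℕ) (w : σ → ℕ) (hw : ∀ a, B * ∑ b, (if r a b then w b else 0) < w a)
    (ν μ : σ → ℕ) (hB : ∀ b, ν b ≤ B) (a : σ) (h1 : ∀ b, r b a → ν b = μ b) (h2 : ν a < μ a) :
    ∑ b, ν b * w b < ∑ b, μ b * w b := by
  have key : ∑ b, (ν b * w b + if b = a then w a else 0) ≤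
      ∑ b, (μ b * w b + B * if r a b then w b else 0) := by
    apply Finset.sum_le_sum
    intro b _
    rcases htri a b with h | h | h
    · have hne : b ≠ a := by rintro rfl; exact hirr _ h
      simp only [h, hne, if_true, if_false]
      have := Nat.mul_le_mul_right (w b) (hB b)
      omega
    · subst h
      simp only [if_true, hirr, if_false]
      have := Nat.mul_le_mul_right (w a) h2
      nlinarith
    · have hne : b ≠ a := by rintro rfl; exact hirr _ h
      simp only [hne, if_false, h1 b h]
      omega
  rw [Finset.sum_add_distrib, Finset.sum_add_distrib, ← Finset.mul_sum] at key
  simp only [Finset.sum_ite_eq', Finset.mem_univ, if_true] at key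
  have := hw a
  omega

/-- colouring or long chain -/
lemma chain_or_color {m n : ℕ} (s : ℕ) (T : Set (Fin m × Fin n)) :
    (∃ (r : Fin (s+1) → Fin m) (c : Fin (s+1) → Fin n), StrictMono r ∧ StrictMono c ∧
      ∀ i, (r i, c i) ∈ T) ∨
    ∃ h : Fin m × Fin n → ℕ, (∀ x ∈ T, h x < s) ∧
      ∀ x ∈ T, ∀ y ∈ T, h x = h y → ¬ (x.1 < y.1 ∧ x.2 < y.2) := by
  classical
  induction s generalizing T with
  | zero =>
    by_cases hT : T.Nonempty
    · obtain ⟨x, hx⟩ := hT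
      exact Or.inl ⟨fun _ => x.1, fun _ => x.2,
        fun a b hab => by omega, fun a b hab => by omega,
        fun _ => hx⟩
    · rw [Set.not_nonempty_iff_eq_empty] at hT
      subst hT
      exact Or.inr ⟨fun _ => 0, by simp, by simp⟩
  | succ s ih =>
    let T' : Set (Fin m × Fin n) := {x | x ∈ T ∧ ∃ y ∈ T, y.1 < x.1 ∧ y.2 < x.2}
    rcases ih T' with ⟨r, c, hr, hc, h⟩ | ⟨h, h1, h2⟩
    · left
      obtain ⟨h0, y, hy, hy1, hy2⟩ := h 0
      refine ⟨Fin.cons y.1 r, Fin.cons y.2 c, ?_, ?_, ?_⟩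
      · rw [Fin.strictMono_iff_lt_succ]
        intro i
        refine Fin.cases ?_ (fun j => ?_) i
        · simpa using hy1
        · rw [Fin.cons_succ, ← Fin.succ_castSucc, Fin.cons_succ]
          exact hr (Fin.castSucc_lt_succ)
      · rw [Fin.strictMono_iff_lt_succ]
        intro i
        refine Fin.cases ?_ (fun j => ?_) i
        · simpa using hy2
        · rw [Fin.cons_succ, ← Fin.succ_castSucc, Fin.cons_succ]
          exact hc (Fin.castSucc_lt_succ)
      · intro i
        refine Fin.cases ?_ (fun j => ?_) i
        · simpa using hy
        · simpa using (h j).1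
    · right
      refine ⟨fun x => if x ∈ T' then h x else s, ?_, ?_⟩
      · intro x hx
        by_cases hx' : x ∈ T'
        · simp only [hx', if_true]; have := h1 x hx'; omega
        · simp [hx']
      · intro x hx y hy hxy hlt
        have hy' : y ∈ T' := ⟨hy, x, hx, hlt⟩
        by_cases hx' : x ∈ T'
        · simp only [hx', hy', if_true] at hxy
          exact h2 x hx' y hy' hxy hlt
        · simp only [hx', hy', if_true, if_false] at hxy
          have := h1 y hy'
          omega

/-- tropical rank one completion -/
lemma potential (m n : ℕ) (w : ℕ → ℕ → ℤ)
    (hw : ∀ i j l, j < l → w i l + w (i+1) j ≤ w i j + w (i+1) l)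
    (T : Set (ℕ × ℕ)) (hT : ∀ x ∈ T, x.1 < m ∧ x.2 < n)
    (hd : ∀ x ∈ T, ∀ y ∈ T, ¬ (x.1 < y.1 ∧ x.2 < y.2)) :
    ∃ α β : ℕ → ℤ, (∀ i j, i < m → α i + β j ≤ w i j) ∧ ∀ x ∈ T, α x.1 + β x.2 = w x.1 x.2 := by
  classical
  by_cases hm : m = 0
  · subst hm
    exact ⟨0, 0, by simp, fun x hx => absurd (hT x hx).1 (by simp)⟩
  let U : ℕ → Set ℕ := fun i => {j | j = n ∨ ∃ i' ≤ i, (i', j) ∈ T}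
  have hU : ∀ i, (U i).Nonempty := fun i => ⟨n, Or.inl rfl⟩
  let c : ℕ → ℕ := fun i => sInf (U i)
  have hc1 : ∀ x ∈ T, ∀ i, x.1 ≤ i → c i ≤ x.2 := fun x hx i hi =>
    Nat.sInf_le (Or.inr ⟨x.1, hi, hx⟩)
  have hc2 : ∀ x ∈ T, ∀ i, i < x.1 → x.2 ≤ c i := by
    intro x hx i hi
    rcases Nat.sInf_mem (hU i) with h | ⟨i', hi', h⟩
    · change x.2 ≤ sInf (U i)
      rw [h]; exact (hT x hx).2.le
    · by_contra hcon
      exact hd _ h x hx ⟨lt_of_le_of_lt hi' hi, not_le.1 hcon⟩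
  let α : ℕ → ℤ := fun i => ∑ k ∈ Finset.range i, (w (k+1) (c k) - w k (c k))
  have hα : ∀ i, α (i+1) = α i + (w (i+1) (c i) - w i (c i)) := fun i => Finset.sum_range_succ _ _
  have hne : (Finset.range m).Nonempty := by simpa using hm
  have hex : ∀ j, ∃ i ∈ Finset.range m, ∀ i' ∈ Finset.range m, w i j - α i ≤ w i' j - α i' :=
    fun j => Finset.exists_min_image _ _ hne
  choose g hg hgmin using hex
  refine ⟨α, fun j => w (g j) j - α (g j), ?_, ?_⟩
  · intro i j hi
    have := hgmin j i (by simpa using hi)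
    linarith
  · intro x hx
    have h1 := hgmin x.2 x.1 (by simpa using (hT x hx).1)
    have up : ∀ k, w x.1 x.2 - α x.1 ≤ w (x.1 + k) x.2 - α (x.1 + k) := by
      intro k
      induction k with
      | zero => simp
      | succ k ih =>
        refine ih.trans ?_
        rw [← add_assoc, hα]
        have := hc1 x hx (x.1 + k) (by omega)
        rcases this.lt_or_eq with h | h
        · have := hw (x.1 + k) _ _ h
          linarith
        · rw [h]; linarith
    have down : ∀ k, ∀ i, i + k = x.1 → w x.1 x.2 - α x.1 ≤ w i x.2 - α i := by
      intro k
      induction k with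
      | zero => intro i hi; simp at hi; rw [hi]
      | succ k ih =>
        intro i hi
        refine (ih (i+1) (by omega)).trans ?_
        rw [hα]
        have := hc2 x hx i (by omega)
        rcases this.lt_or_eq with h | h
        · have := hw i _ _ h
          linarith
        · rw [h]; linarith
    have h2 : w x.1 x.2 - α x.1 ≤ w (g x.2) x.2 - α (g x.2) := by
      rcases le_total x.1 (g x.2) with h | h
      · obtain ⟨k, hk⟩ := Nat.exists_eq_add_of_le h
        rw [hk]; exact up k
      · obtain ⟨k, hk⟩ := Nat.exists_eq_add_of_le h
        exact down k _ hk.symm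
    simp only
    linarith

/-- The generic rank `s` parametrisation on the columns in `W`. -/
noncomputable def phi (K : Type*) [Field K] (m n s : ℕ) (W : Fin n → Prop) [DecidablePred W] :
    MvPolynomial (Fin m × Fin n) K →ₐ[K]
      MvPolynomial ((Fin m × Fin s) ⊕ (Fin s × Fin n) ⊕ (Fin m × Fin n)) K :=
  MvPolynomial.aeval fun p => if W p.2 then
    ∑ k, MvPolynomial.X (Sum.inl (p.1, k)) * MvPolynomial.X (Sum.inr (Sum.inl (k, p.2)))
    else MvPolynomial.X (Sum.inr (Sum.inr p))

lemma phi_eval {K : Type*} [Field K] {m n s : ℕ} {W : Fin n → Prop} [DecidablePred W]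
    (f : MvPolynomial (Fin m × Fin n) K) (hf : phi K m n s W f = 0)
    {F : Type*} [CommRing F] [Algebra K F] (Y : Fin m → Fin s → F) (Z : Fin s → Fin n → F)
    (x : Fin m × Fin n → F) :
    MvPolynomial.aeval (fun p : Fin m × Fin n =>
      if W p.2 then ∑ k, Y p.1 k * Z k p.2 else x p) f = 0 := by
  let e : MvPolynomial ((Fin m × Fin s) ⊕ (Fin s × Fin n) ⊕ (Fin m × Fin n)) K →ₐ[K] F :=
    MvPolynomial.aeval (Sum.elim (fun p => Y p.1 p.2) (Sum.elim (fun p => Z p.1 p.2) x))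
  have h : e.comp (phi K m n s W) = MvPolynomial.aeval (fun p : Fin m × Fin n =>
      if W p.2 then ∑ k, Y p.1 k * Z k p.2 else x p) := by
    apply MvPolynomial.algHom_ext
    intro p
    simp only [AlgHom.comp_apply, phi, MvPolynomial.aeval_X]
    split_ifs <;> simp [e]
  rw [← h, AlgHom.comp_apply, hf, map_zero]

open Polynomial in
lemma eval_core {K : Type*} [Field K] {σ : Type*} [Fintype σ] (R : Type*) [CommRing R] [IsDomain R]
    [Algebra K R] (f : MvPolynomial σ K) (μ : σ →₀ ℕ) (hμ : f.coeff μ ≠ 0) (w : σ → ℕ)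
    (hlt : ∀ ν ∈ f.support, ν ≠ μ → ∑ a, ν a * w a < ∑ a, μ a * w a)
    (Xt : σ → R[X]) (h0 : ∀ a, μ a ≠ 0 → (Xt a).eval 0 ≠ 0) :
    MvPolynomial.aeval (fun a => (algebraMap R[X] (FractionRing R[X]) X) ^ (-(w a : ℤ)) *
      algebraMap R[X] (FractionRing R[X]) (Xt a)) f ≠ 0 := by
  intro hz
  set P := algebraMap R[X] (FractionRing R[X]) X with hP
  have hP0 : P ≠ 0 := by
    rw [hP, Ne, FaithfulSMul.algebraMap_eq_zero_iff]; exact X_ne_zero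
  have hle : ∀ ν ∈ f.support, ∑ a, ν a * w a ≤ ∑ a, μ a * w a := by
    intro ν hν
    by_cases h : ν = μ
    · rw [h]
    · exact (hlt ν hν h).le
  let G : R[X] := ∑ ν ∈ f.support, algebraMap K R[X] (f.coeff ν) *
    (X ^ (∑ a, μ a * w a - ∑ a, ν a * w a) * ∏ a, Xt a ^ ν a)
  have hG : G = 0 := by
    have hinj : Function.Injective (algebraMap R[X] (FractionRing R[X])) :=
      IsFractionRing.injective _ _
    apply hinj
    rw [map_zero, ← mul_zero (P ^ (∑ a, μ a * w a)), ← hz, MvPolynomial.aeval_def,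
      MvPolynomial.eval₂_eq', Finset.mul_sum, map_sum]
    apply Finset.sum_congr rfl
    intro ν hν
    have h1 : ∏ a, (P ^ (-(w a : ℤ)) * algebraMap R[X] (FractionRing R[X]) (Xt a)) ^ ν a
        = (P ^ (∑ a, ν a * w a))⁻¹ * ∏ a, algebraMap R[X] (FractionRing R[X]) (Xt a) ^ ν a := by
      simp_rw [mul_pow]
      rw [Finset.prod_mul_distrib, ← Finset.prod_pow_eq_pow_sum, ← Finset.prod_inv_distrib]
      congr 1
      apply Finset.prod_congr rfl
      intro a _
      rw [zpow_neg, zpow_natCast, inv_pow, ← pow_mul, mul_comm]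
    rw [h1]
    simp only [map_mul, map_pow, map_prod]
    rw [← hP, ← IsScalarTower.algebraMap_apply, pow_sub₀ _ hP0 (hle ν hν)]
    ring
  have hev : G.eval 0 = algebraMap K R (f.coeff μ) * ∏ a, (Xt a).eval 0 ^ μ a := by
    simp only [G, eval_finsetSum]
    rw [Finset.sum_eq_single μ]
    · simp [eval_prod, IsScalarTower.algebraMap_apply K R R[X]]
    · intro ν hν hne
      have := hlt ν hν hne
      have h2 : ∑ a, μ a * w a - ∑ a, ν a * w a ≠ 0 := by omega
      simp [h2]
    · intro h
      rw [MvPolynomial.notMem_support_iff] at h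
      exact absurd h hμ
  rw [hG, eval_zero] at hev
  have h3 : algebraMap K R (f.coeff μ) ≠ 0 := by
    rw [Ne, FaithfulSMul.algebraMap_eq_zero_iff]; exact hμ
  have h4 : ∏ a, (Xt a).eval 0 ^ μ a ≠ 0 := by
    rw [Finset.prod_ne_zero_iff]
    intro a _
    by_cases ha : μ a = 0
    · rw [ha, pow_zero]; exact one_ne_zero
    · exact pow_ne_zero _ (h0 a ha)
  exact mul_ne_zero h3 h4 hev.symm

instance {m n : ℕ} : IsTrans (Fin m × Fin n) rl := ⟨by
  rintro ⟨a, b⟩ ⟨c, d⟩ ⟨e, f⟩ h1 h2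
  simp only [rl] at *
  omega⟩

instance {m n : ℕ} : Std.Irrefl (rl : Fin m × Fin n → Fin m × Fin n → Prop) := ⟨by
  rintro ⟨a, b⟩ h1
  simp only [rl] at *
  omega⟩

open Polynomial in
lemma phi_ne_zero {K : Type*} [Field K] {m n s : ℕ} {W : Fin n → Prop} [DecidablePred W]
    (f : MvPolynomial (Fin m × Fin n) K) (hf : f ≠ 0) (h : Fin m × Fin n → ℕ)
    (h1 : ∀ x, (mo m n).degree f x ≠ 0 → W x.2 → h x < s)
    (h2 : ∀ x y, (mo m n).degree f x ≠ 0 → W x.2 → (mo m n).degree f y ≠ 0 → W y.2 →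
      h x = h y → ¬ (x.1 < y.1 ∧ x.2 < y.2)) :
    phi K m n s W f ≠ 0 := by
  classical
  intro hphi
  set μ := (mo m n).degree f with hμ
  let B := 1 + f.totalDegree
  have hB : ∀ ν ∈ f.support, ∀ b, ν b ≤ B := by
    intro ν hν b
    have h1 := MvPolynomial.monomial_le_degreeOf b hν
    have h2 := MvPolynomial.degreeOf_le_totalDegree f b
    omega
  obtain ⟨w, hw⟩ := exists_weight (rl : Fin m × Fin n → Fin m × Fin n → Prop) B
  have hsm : ∀ p q q' : Fin m × Fin n, rl p q → rl p q' → q ≠ q' → w q + w q' ≤ w p := by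
    intro p q q' hq hq' hne
    have h3 : ∑ b ∈ {q, q'}, (if rl p b then w b else 0) ≤ ∑ b, (if rl p b then w b else 0) :=
      Finset.sum_le_sum_of_subset (Finset.subset_univ _)
    rw [Finset.sum_pair hne, if_pos hq, if_pos hq'] at h3
    have := hw p
    have h4 : ∑ b, (if rl p b then w b else 0) ≤ B * ∑ b, (if rl p b then w b else 0) :=
      Nat.le_mul_of_pos_left _ (by omega)
    omega
  have hlt : ∀ ν ∈ f.support, ν ≠ μ → ∑ a, ν a * w a < ∑ a, μ a * w a := by
    intro ν hν hne
    have hle := (mo m n).le_degree hν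
    have hlt' : (mo m n).toSyn ν < (mo m n).toSyn μ :=
      lt_of_le_of_ne hle (fun he => hne ((mo m n).toSyn.injective he))
    obtain ⟨p, hp1, hp2⟩ := (mo_lt_iff ν μ).1 hlt'
    refine weight_lt rl ?_ ?_ B w hw ν μ (hB ν hν) p hp1 hp2
    · rintro ⟨a, b⟩ ⟨c, d⟩
      simp only [rl, Prod.mk.injEq]
      omega
    · rintro ⟨a, b⟩
      simp [rl]
  let wN : ℕ → ℕ → ℤ := fun i j =>
    if hij : i < m ∧ j < n then (w (⟨i, hij.1⟩, ⟨j, hij.2⟩) : ℤ) else 0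
  have hwN : ∀ i j l, j < l → wN i l + wN (i+1) j ≤ wN i j + wN (i+1) l := by
    intro i j l hjl
    have hnn : ∀ a b, 0 ≤ wN a b := by
      intro a b; simp only [wN]; split_ifs <;> simp
    by_cases hij : i < m ∧ j < n
    · suffices wN i l + wN (i+1) j ≤ wN i j by linarith [hnn (i+1) l]
      have hwp : ∀ q, rl ((⟨i, hij.1⟩, ⟨j, hij.2⟩) : Fin m × Fin n) q →
          w q ≤ w (⟨i, hij.1⟩, ⟨j, hij.2⟩) := by
        intro q hq
        have h3 := Finset.single_le_sum (f := fun b => if rl ((⟨i, hij.1⟩, ⟨j, hij.2⟩) : Fin m × Fin n) b then w b else 0) (fun _ _ => Nat.zero_le _) (Finset.mem_univ q)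
        simp only [if_pos hq] at h3
        have := hw (⟨i, hij.1⟩, ⟨j, hij.2⟩)
        have h4 := Nat.le_mul_of_pos_left (∑ b, (if rl ((⟨i, hij.1⟩, ⟨j, hij.2⟩) : Fin m × Fin n) b then w b else 0)) (show 0 < B by omega)
        omega
      by_cases hil : i < m ∧ l < n
      · by_cases hkj : i + 1 < m ∧ j < n
        · simp only [wN, dif_pos hij, dif_pos hil, dif_pos hkj]
          have := hsm (⟨i, hij.1⟩, ⟨j, hij.2⟩) (⟨i, hil.1⟩, ⟨l, hil.2⟩) (⟨i+1, hkj.1⟩, ⟨j, hkj.2⟩)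
            (by simp [rl, hjl]) (by simp [rl]) (by simp)
          exact_mod_cast this
        · simp only [wN, dif_pos hij, dif_pos hil, dif_neg hkj]
          have := hwp (⟨i, hil.1⟩, ⟨l, hil.2⟩) (by simp [rl, hjl])
          rw [add_zero]
          exact_mod_cast this
      · by_cases hkj : i + 1 < m ∧ j < n
        · simp only [wN, dif_pos hij, dif_neg hil, dif_pos hkj]
          have := hwp (⟨i+1, hkj.1⟩, ⟨j, hkj.2⟩) (by simp [rl])
          rw [zero_add]
          exact_mod_cast this
        · simp only [wN, dif_pos hij, dif_neg hil, dif_neg hkj]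
          positivity
    · have e1 : ¬ (i < m ∧ l < n) := by omega
      have e2 : ¬ (i + 1 < m ∧ j < n) := by omega
      have e3 : ¬ (i + 1 < m ∧ l < n) := by omega
      simp [wN, hij, e1, e2, e3]
  have hpot : ∀ k : Fin s, ∃ α β : ℕ → ℤ, (∀ p : Fin m × Fin n, α p.1 + β p.2 ≤ w p) ∧
      ∀ p : Fin m × Fin n, μ p ≠ 0 → W p.2 → h p = k → α p.1 + β p.2 = w p := by
    intro k
    have hwNp : ∀ p : Fin m × Fin n, wN p.1 p.2 = w p := by
      intro p; simp [wN]
    obtain ⟨α, β, ha, hb⟩ := potential m n wN hwN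
      {x | ∃ p : Fin m × Fin n, μ p ≠ 0 ∧ W p.2 ∧ h p = k ∧ x = ((p.1 : ℕ), (p.2 : ℕ))}
      (by rintro x ⟨p, -, -, -, rfl⟩; exact ⟨p.1.2, p.2.2⟩)
      (by
        rintro x ⟨p, hp1, hp2, hp3, rfl⟩ y ⟨q, hq1, hq2, hq3, rfl⟩ hlt
        exact h2 p q hp1 hp2 hq1 hq2 (hp3.trans hq3.symm) hlt)
    refine ⟨α, β, fun p => ?_, fun p hp1 hp2 hp3 => ?_⟩
    · rw [← hwNp]; exact ha _ _ p.1.2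
    · rw [← hwNp]; exact hb _ ⟨p, hp1, hp2, hp3, rfl⟩
  choose α β hαβ hαβeq using hpot
  let R := MvPolynomial (Fin s) K
  let D : Fin s → Fin m × Fin n → ℕ := fun k p => ((w p : ℤ) - α k p.1 - β k p.2).toNat
  have hD : ∀ k p, (D k p : ℤ) = (w p : ℤ) - α k p.1 - β k p.2 := by
    intro k p
    have := hαβ k p
    exact Int.toNat_of_nonneg (by linarith)
  let Xt : Fin m × Fin n → R[X] := fun p =>
    if W p.2 then ∑ k, C (MvPolynomial.X k : R) * X ^ D k p else 1
  have h0 : ∀ a, μ a ≠ 0 → (Xt a).eval 0 ≠ 0 := by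
    intro p hp
    by_cases hW : W p.2
    · simp only [Xt, if_pos hW, eval_finsetSum, eval_mul, eval_C, eval_pow, eval_X]
      intro hz
      have hk := h1 p hp hW
      have hz2 := congrArg (MvPolynomial.eval (Pi.single (⟨h p, hk⟩ : Fin s) (1 : K))) hz
      rw [map_sum, Finset.sum_eq_single (⟨h p, hk⟩ : Fin s)] at hz2
      · have : D ⟨h p, hk⟩ p = 0 := by
          have e1 := hD ⟨h p, hk⟩ p
          have e2 := hαβeq ⟨h p, hk⟩ p hp hW rfl
          have : (D ⟨h p, hk⟩ p : ℤ) = 0 := by linarith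
          exact_mod_cast this
        simp [this] at hz2
      · intro k _ hne
        simp [hne]
      · simp
    · simp [Xt, hW]
  have hcμ : f.coeff μ ≠ 0 := (mo m n).coeff_degree_ne_zero_iff.2 hf
  have hmain := eval_core R f μ hcμ w hlt Xt h0
  apply hmain
  set P := algebraMap R[X] (FractionRing R[X]) X with hP
  have hP0 : P ≠ 0 := by
    rw [hP, Ne, FaithfulSMul.algebraMap_eq_zero_iff]; exact X_ne_zero
  have hfin := phi_eval f hphi (F := FractionRing R[X])
    (fun i k => algebraMap R[X] (FractionRing R[X]) (C (MvPolynomial.X k : R)) * P ^ (-α k i))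
    (fun k j => P ^ (-β k j)) (fun p => P ^ (-(w p : ℤ)))
  refine Eq.trans (congrArg (fun g : Fin m × Fin n → FractionRing R[X] =>
    MvPolynomial.aeval (R := K) g f) (funext fun p => ?_)) hfin
  by_cases hW : W p.2
  · simp only [Xt, if_pos hW, map_sum, Finset.mul_sum]
    apply Finset.sum_congr rfl
    intro k _
    have e := hD k p
    rw [map_mul, map_pow, ← hP, ← zpow_natCast, e]
    rw [show -(w p : ℤ) = -α k p.1 + -β k p.2 - ((w p : ℤ) - α k p.1 - β k p.2) by ring,
      zpow_sub₀ hP0, zpow_add₀ hP0]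
    have := zpow_ne_zero ((w p : ℤ) - α k p.1 - β k p.2) hP0
    rw [mul_left_comm, div_mul_cancel₀ _ this, mul_assoc]
  · simp [Xt, hW]

/-- leading exponents of kernel elements contain a long diagonal -/
lemma lead_chain {K : Type*} [Field K] {m n s : ℕ} {W : Fin n → Prop} [DecidablePred W]
    (f : MvPolynomial (Fin m × Fin n) K) (hf : f ≠ 0) (hphi : phi K m n s W f = 0) :
    ∃ (r : Fin (s+1) → Fin m) (c : Fin (s+1) → Fin n), StrictMono r ∧ StrictMono c ∧
      (∀ i, W (c i)) ∧ ∀ i, (mo m n).degree f (r i, c i) ≠ 0 := by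
  rcases chain_or_color s {x : Fin m × Fin n | (mo m n).degree f x ≠ 0 ∧ W x.2} with
    ⟨r, c, hr, hc, h⟩ | ⟨h, h1, h2⟩
  · exact ⟨r, c, hr, hc, fun i => (h i).2, fun i => (h i).1⟩
  · exact absurd hphi (phi_ne_zero f hf h (fun x hx hW => h1 x ⟨hx, hW⟩)
      (fun x y hx hxW hy hyW => h2 x ⟨hx, hxW⟩ y ⟨hy, hyW⟩))

lemma phi_minor {K : Type*} [Field K] {m n s : ℕ} {W : Fin n → Prop} [DecidablePred W]
    (r : Fin (s+1) → Fin m) (c : Fin (s+1) → Fin n) (hc : ∀ i, W (c i)) :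
    phi K m n s W (minor K r c) = 0 := by
  unfold minor
  rw [AlgHom.map_det]
  let A : Matrix (Fin (s+1)) (Fin (s+1))
      (MvPolynomial ((Fin m × Fin s) ⊕ (Fin s × Fin n) ⊕ (Fin m × Fin n)) K) :=
    Matrix.of fun i => Fin.cons 0 (fun k => MvPolynomial.X (Sum.inl (r i, k)))
  let Bm : Matrix (Fin (s+1)) (Fin (s+1))
      (MvPolynomial ((Fin m × Fin s) ⊕ (Fin s × Fin n) ⊕ (Fin m × Fin n)) K) :=
    Matrix.of fun k j => (Fin.cons 0 (fun k => MvPolynomial.X (Sum.inr (Sum.inl (k, c j)))) : Fin (s+1) → _) k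
  have hAB : (phi K m n s W).mapMatrix (Matrix.of fun i j => MvPolynomial.X (r i, c j)) = A * Bm := by
    ext1 i j
    rw [Matrix.mul_apply, Fin.sum_univ_succ]
    simp [A, Bm, phi, hc]
  rw [hAB, Matrix.det_mul, Matrix.det_eq_zero_of_column_eq_zero 0 (A := A), zero_mul]
  intro i
  simp [A]



abbrev Win (n c1 c2 : ℕ) (j : Fin n) : Prop := c1 ≤ j.val + 1 ∧ j.val + 1 ≤ c2

lemma sm_gap {t n : ℕ} (c : Fin t → Fin n) (hc : StrictMono c) :
    ∀ d : ℕ, ∀ i j : Fin t, i.val + d = j.val → (c i).val + d ≤ (c j).val := by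
  intro d
  induction d with
  | zero => intro i j h; have : i = j := Fin.ext (by omega); rw [this]; omega
  | succ d ih =>
    intro i j h
    have h1 := ih i ⟨i.val + d, by omega⟩ rfl
    have h2 : c ⟨i.val + d, by omega⟩ < c j := hc (by rw [Fin.lt_def]; simp; omega)
    rw [Fin.lt_def] at h2
    omega

/-- The generating set of `genMinors`. -/
def gset (K : Type*) [Field K] (m n t c1 c2 : ℕ) : Set (MvPolynomial (Fin m × Fin n) K) :=
  {p | ∃ (r : Fin t → Fin m) (c : Fin t → Fin n), StrictMono r ∧ StrictMono c ∧
    (∀ j, Win n c1 c2 (c j)) ∧ p = minor K r c}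

lemma genMinors_eq_span (K : Type*) [Field K] (m n t c1 c2 : ℕ) :
    genMinors K m n t 1 m c1 c2 = Ideal.span (gset K m n t c1 c2) := by
  unfold genMinors gset
  congr 1
  ext p
  constructor
  · rintro ⟨r, c, hr, hc, -, h2, h3⟩
    exact ⟨r, c, hr, hc, h2, h3⟩
  · rintro ⟨r, c, hr, hc, h2, h3⟩
    exact ⟨r, c, hr, hc, fun i => ⟨by omega, by omega⟩, h2, h3⟩

lemma genMinors_eq_ker (K : Type*) [Field K] (m n s c1 c2 : ℕ) :
    genMinors K m n (s+1) 1 m c1 c2 = RingHom.ker (phi K m n s (Win n c1 c2)) := by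
  rw [genMinors_eq_span]
  apply groebner_span (mo m n)
  · rintro g ⟨r, c, hr, hc, -, rfl⟩
    exact (minor_degree K r c hr hc).2
  · rintro g ⟨r, c, hr, hc, h, rfl⟩
    exact phi_minor r c h
  · intro f hf hf0
    obtain ⟨r, c, hr, hc, hW, h⟩ := lead_chain f hf0 hf
    refine ⟨minor K r c, ⟨r, c, hr, hc, hW, rfl⟩, ?_⟩
    rw [(minor_degree K r c hr hc).1]
    exact pm_le r c hr _ h

lemma genMinors_prime (K : Type*) [Field K] (m n s c1 c2 : ℕ) :
    (genMinors K m n (s+1) 1 m c1 c2).IsPrime := by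
  rw [genMinors_eq_ker]
  exact RingHom.ker_isPrime _

lemma genMinors_lead {K : Type*} [Field K] {m n s c1 c2 : ℕ} (f : MvPolynomial (Fin m × Fin n) K)
    (hf : f ∈ genMinors K m n (s+1) 1 m c1 c2) (hf0 : f ≠ 0) :
    ∃ (r : Fin (s+1) → Fin m) (c : Fin (s+1) → Fin n), StrictMono r ∧ StrictMono c ∧
      (∀ i, Win n c1 c2 (c i)) ∧ ∀ i, (mo m n).degree f (r i, c i) ≠ 0 := by
  rw [genMinors_eq_ker] at hf
  exact lead_chain f hf0 hf

lemma minor_ne_zero (K : Type*) [Field K] {m n t : ℕ} (r : Fin t → Fin m) (c : Fin t → Fin n)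
    (hr : StrictMono r) (hc : StrictMono c) : minor K r c ≠ 0 := by
  intro h
  have := (minor_degree K r c hr hc).2
  rw [h] at this
  simp at this

lemma genMinors_mono (K : Type*) [Field K] (m n t c1 c2 c1' c2' : ℕ) (h1 : c1' ≤ c1)
    (h2 : c2 ≤ c2') : genMinors K m n t 1 m c1 c2 ≤ genMinors K m n t 1 m c1' c2' := by
  rw [genMinors_eq_span, genMinors_eq_span]
  apply Ideal.span_mono
  rintro p ⟨r, c, hr, hc, h, rfl⟩
  exact ⟨r, c, hr, hc, fun j => by have := h j; simp only [Win] at *; omega, rfl⟩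

lemma left_le (K : Type*) [Field K] (m n u : ℕ) :
    genMinors K m n (u+2) 1 m 1 (u+2) ≤ genMinors K m n (u+1) 1 m 2 (u+2) := by
  rw [genMinors_eq_span, genMinors_eq_span, Ideal.span_le]
  rintro p ⟨r, c, hr, hc, h, rfl⟩
  simp only [minor, SetLike.mem_coe]
  rw [Matrix.det_succ_column_zero]
  apply Ideal.sum_mem
  intro i _
  apply Ideal.mul_mem_left
  apply Ideal.subset_span
  refine ⟨r ∘ i.succAbove, c ∘ Fin.succ, hr.comp (Fin.strictMono_succAbove i),
    hc.comp Fin.strictMono_succ, ?_, rfl⟩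
  intro j
  have h1 := h j.succ
  have h2 : c 0 < c j.succ := hc (Fin.succ_pos j)
  rw [Fin.lt_def] at h2
  simp only [Win, Function.comp] at *
  omega

lemma right_le (K : Type*) [Field K] (m n u : ℕ) :
    genMinors K m n (u+2) 1 m 2 (u+3) ≤ genMinors K m n (u+1) 1 m 2 (u+2) := by
  rw [genMinors_eq_span, genMinors_eq_span, Ideal.span_le]
  rintro p ⟨r, c, hr, hc, h, rfl⟩
  simp only [minor, SetLike.mem_coe]
  rw [Matrix.det_succ_column _ (Fin.last (u+1))]
  apply Ideal.sum_mem
  intro i _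
  apply Ideal.mul_mem_left
  apply Ideal.subset_span
  refine ⟨r ∘ i.succAbove, c ∘ (Fin.last (u+1)).succAbove, hr.comp (Fin.strictMono_succAbove i),
    hc.comp (Fin.strictMono_succAbove _), ?_, rfl⟩
  intro j
  rw [Function.comp, Fin.succAbove_last]
  have h1 := h j.castSucc
  have h3 := h (Fin.last _)
  have h2 : c j.castSucc < c (Fin.last _) := hc (Fin.castSucc_lt_last j)
  rw [Fin.lt_def] at h2
  simp only [Win] at *
  omega

/-- The exchange argument for diagonals. -/
lemma exchange {m n u : ℕ} (T : Fin m × Fin n → Prop)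
    (r : Fin (u+2) → Fin m) (c : Fin (u+2) → Fin n) (hr : StrictMono r) (hc : StrictMono c)
    (hW : ∀ i, Win n 1 (u+3) (c i)) (hT : ∀ i, T (r i, c i))
    (r' : Fin (u+1) → Fin m) (c' : Fin (u+1) → Fin n) (hr' : StrictMono r') (hc' : StrictMono c')
    (hW' : ∀ i, Win n 2 (u+2) (c' i)) (hT' : ∀ i, T (r' i, c' i)) :
    ∃ (ρ : Fin (u+2) → Fin m) (γ : Fin (u+2) → Fin n), StrictMono ρ ∧ StrictMono γ ∧
      ((∀ i, Win n 1 (u+2) (γ i)) ∨ (∀ i, Win n 2 (u+3) (γ i))) ∧ ∀ i, T (ρ i, γ i) := by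
  have hcv' : ∀ i : Fin (u+1), (c' i).val = i.val + 1 := by
    intro i
    have h1 := sm_gap c' hc' i.val 0 i (by simp)
    have h2 := sm_gap c' hc' (u - i.val) i (Fin.last u) (by simp; omega)
    have h3 := hW' 0
    have h4 := hW' (Fin.last u)
    simp only [Win] at h3 h4
    omega
  have hcv : ∀ i : Fin (u+2), i.val ≤ (c i).val ∧ (c i).val ≤ i.val + 1 := by
    intro i
    have h1 := sm_gap c hc i.val 0 i (by simp)
    have h2 := sm_gap c hc (u + 1 - i.val) i (Fin.last (u+1)) (by simp; omega)
    have h3 := hW 0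
    have h4 := hW (Fin.last (u+1))
    simp only [Win] at h3 h4
    omega
  by_cases hall : ∀ i, (c i).val = i.val
  · exact ⟨r, c, hr, hc, Or.inl fun i => by have := hall i; simp only [Win]; omega, hT⟩
  by_cases hall2 : (c 0).val = 1
  · refine ⟨r, c, hr, hc, Or.inr fun i => ?_, hT⟩
    have h1 := sm_gap c hc i.val 0 i (by simp)
    have := hcv i
    simp only [Win]; omega
  obtain ⟨k, hk1, hk2⟩ : ∃ k : Fin (u+2), (c k).val = k.val + 1 ∧ ∀ j < k, (c j).val = j.val := by
    push Not at hall
    obtain ⟨i, hi⟩ := hall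
    have hne : (Finset.univ.filter (fun i : Fin (u+2) => (c i).val ≠ i.val)).Nonempty :=
      ⟨i, by simpa using hi⟩
    refine ⟨Finset.min' _ hne, ?_, ?_⟩
    · have := (Finset.mem_filter.1 (Finset.min'_mem _ hne)).2
      have h2 := hcv (Finset.min' _ hne)
      omega
    · intro j hj
      by_contra hcon
      have := Finset.min'_le (Finset.univ.filter (fun i : Fin (u+2) => (c i).val ≠ i.val)) j
        (by simpa using hcon)
      exact absurd hj (not_lt.2 this)
  have hk3 : ∀ j, k ≤ j → (c j).val = j.val + 1 := by
    intro j hj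
    rw [Fin.le_def] at hj
    have h1 := sm_gap c hc (j.val - k.val) k j (by omega)
    have := hcv j
    omega
  have hk0 : 0 < k.val := by
    rcases Nat.eq_zero_or_pos k.val with h | h
    · have : k = 0 := Fin.ext h
      subst this
      simp at hk1
      exact absurd hk1 hall2
    · exact h
  have hkl := k.2
  let a : Fin (u+2) := ⟨k.val - 1, by omega⟩
  let b : Fin (u+1) := ⟨k.val - 1, by omega⟩
  by_cases hcmp : r a < r' b
  · refine ⟨fun i => if h : i < k then r i else r' ⟨i.val - 1, by omega⟩,
      fun i => if h : i < k then c i else c' ⟨i.val - 1, by omega⟩, ?_, ?_, Or.inl ?_, ?_⟩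
    · intro i j hij
      have hij' := hij
      rw [Fin.lt_def] at hij'
      by_cases hi : i < k <;> by_cases hj : j < k <;> simp only [hi, hj, dif_pos, dif_neg, not_false_eq_true]
      · exact hr hij
      · rw [Fin.lt_def] at hi hj
        have h1 : r i ≤ r a := hr.monotone (by rw [Fin.le_def]; simp only [a]; omega)
        have h2 : r' b ≤ r' ⟨j.val - 1, by omega⟩ := hr'.monotone (by rw [Fin.le_def]; simp only [b]; omega)
        exact lt_of_le_of_lt h1 (lt_of_lt_of_le hcmp h2)
      · exact absurd (hij.trans hj) hi
      · rw [Fin.lt_def] at hi hj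
        exact hr' (by rw [Fin.lt_def]; simp only; omega)
    · have hv : ∀ i : Fin (u+2), ((if h : i < k then c i else c' ⟨i.val - 1, by omega⟩ : Fin n)).val = i.val := by
        intro i
        by_cases hi : i < k
        · rw [dif_pos hi, hk2 i hi]
        · rw [dif_neg hi, hcv']
          rw [Fin.lt_def] at hi
          simp only; omega
      intro i j hij
      rw [Fin.lt_def] at hij ⊢
      simp only [hv]; exact hij
    · intro i
      by_cases hi : i < k
      · simp only [hi, dif_pos, Win, hk2 i hi]; omega
      · simp only [hi, dif_neg, not_false_eq_true, Win, hcv']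
        omega
    · intro i
      by_cases hi : i < k
      · simp only [hi, dif_pos]; exact hT i
      · simp only [hi, dif_neg, not_false_eq_true]; exact hT' _
  · refine ⟨fun i => if h : i < k then r' ⟨i.val, by rw [Fin.lt_def] at h; omega⟩ else r i,
      fun i => if h : i < k then c' ⟨i.val, by rw [Fin.lt_def] at h; omega⟩ else c i,
      ?_, ?_, Or.inr ?_, ?_⟩
    · intro i j hij
      have hij' := hij
      rw [Fin.lt_def] at hij'
      by_cases hi : i < k <;> by_cases hj : j < k <;> simp only [hi, hj, dif_pos, dif_neg, not_false_eq_true]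
      · exact hr' hij'
      · rw [Fin.lt_def] at hi hj
        have h1 : r' ⟨i.val, by omega⟩ ≤ r' b := hr'.monotone (by rw [Fin.le_def]; simp only [b]; omega)
        have h2 : r a < r j := hr (by rw [Fin.lt_def]; simp only [a]; omega)
        exact lt_of_le_of_lt (h1.trans (not_lt.1 hcmp)) h2
      · exact absurd (hij.trans hj) hi
      · exact hr hij
    · have hv : ∀ i : Fin (u+2), ((if h : i < k then c' ⟨i.val, by rw [Fin.lt_def] at h; omega⟩ else c i : Fin n)).val = i.val + 1 := by
        intro i
        by_cases hi : i < k
        · rw [dif_pos hi, hcv']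
        · rw [dif_neg hi, hk3 i (not_lt.1 hi)]
      intro i j hij
      rw [Fin.lt_def] at hij ⊢
      simp only [hv]; omega
    · intro i
      by_cases hi : i < k
      · simp only [hi, dif_pos, Win, hcv']; omega
      · simp only [hi, dif_neg, not_false_eq_true, Win, hk3 i (not_lt.1 hi)]
        omega
    · intro i
      by_cases hi : i < k
      · simp only [hi, dif_pos]; exact hT' _
      · simp only [hi, dif_neg, not_false_eq_true]; exact hT _

lemma sum_eq_inf (K : Type*) [Field K] (m n u : ℕ) :
    genMinors K m n (u+2) 1 m 1 (u+2) + genMinors K m n (u+2) 1 m 2 (u+3)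
      = genMinors K m n (u+2) 1 m 1 (u+3) ⊓ genMinors K m n (u+1) 1 m 2 (u+2) := by
  have hle : genMinors K m n (u+2) 1 m 1 (u+2) + genMinors K m n (u+2) 1 m 2 (u+3)
      ≤ genMinors K m n (u+2) 1 m 1 (u+3) ⊓ genMinors K m n (u+1) 1 m 2 (u+2) := by
    rw [Submodule.add_eq_sup]
    exact sup_le (le_inf (genMinors_mono K m n _ _ _ _ _ le_rfl (by omega)) (left_le K m n u))
      (le_inf (genMinors_mono K m n _ _ _ _ _ (by omega) le_rfl) (right_le K m n u))
  have hspan : genMinors K m n (u+2) 1 m 1 (u+2) + genMinors K m n (u+2) 1 m 2 (u+3) =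
      Ideal.span (gset K m n (u+2) 1 (u+2) ∪ gset K m n (u+2) 2 (u+3)) := by
    rw [Ideal.span_union, Submodule.add_eq_sup, genMinors_eq_span, genMinors_eq_span]
  rw [hspan] at hle ⊢
  apply groebner_span (mo m n)
  · rintro g (⟨r, c, hr, hc, -, rfl⟩ | ⟨r, c, hr, hc, -, rfl⟩)
    · exact (minor_degree K r c hr hc).2
    · exact (minor_degree K r c hr hc).2
  · intro g hg
    exact hle (Ideal.subset_span hg)
  · rintro f ⟨hf1, hf2⟩ hf0
    obtain ⟨r, c, hr, hc, hW, hT⟩ := genMinors_lead f hf1 hf0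
    obtain ⟨r', c', hr', hc', hW', hT'⟩ := genMinors_lead f hf2 hf0
    obtain ⟨ρ, γ, hρ, hγ, hWγ, hTγ⟩ := exchange (fun p => (mo m n).degree f p ≠ 0)
      r c hr hc hW hT r' c' hr' hc' hW' hT'
    refine ⟨minor K ρ γ, ?_, ?_⟩
    · rcases hWγ with h | h
      · exact Or.inl ⟨ρ, γ, hρ, hγ, h, rfl⟩
      · exact Or.inr ⟨ρ, γ, hρ, hγ, h, rfl⟩
    · rw [(minor_degree K ρ γ hρ hγ).1]
      exact pm_le ρ γ hρ _ hTγ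

lemma not_le_one (K : Type*) [Field K] (m n u : ℕ) (hm : u + 2 ≤ m) (hn : u + 3 ≤ n) :
    ¬ genMinors K m n (u+2) 1 m 1 (u+3) ≤ genMinors K m n (u+1) 1 m 2 (u+2) := by
  intro hle
  let r : Fin (u+2) → Fin m := fun i => ⟨i.val, by omega⟩
  let c : Fin (u+2) → Fin n := fun i => ⟨if i.val = 0 then 0 else i.val + 1, by split_ifs <;> omega⟩
  have hr : StrictMono r := fun i j h => h
  have hc : StrictMono c := by
    intro i j h
    rw [Fin.lt_def] at h ⊢
    simp only [c]
    split_ifs <;> omega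
  have hmem : minor K r c ∈ genMinors K m n (u+2) 1 m 1 (u+3) := by
    rw [genMinors_eq_span]
    refine Ideal.subset_span ⟨r, c, hr, hc, fun j => ?_, rfl⟩
    simp only [c, Win]
    split_ifs <;> omega
  obtain ⟨r', c', hr', hc', hW', hT'⟩ := genMinors_lead _ (hle hmem) (minor_ne_zero K r c hr hc)
  rw [(minor_degree K r c hr hc).1] at hT'
  obtain ⟨i, hi⟩ := pm_ne _ _ _ (hT' 0)
  have h1 := congrArg (fun p => p.2.val) hi
  have h3 := hW' 0
  have h4 := hW' (Fin.last u)
  have h5 := sm_gap c' hc' u 0 (Fin.last u) (by simp)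
  simp only [c, Win] at h1 h3 h4
  split_ifs at h1 <;> omega

lemma not_le_two (K : Type*) [Field K] (m n u : ℕ) (hm : u + 2 ≤ m) (hn : u + 3 ≤ n) :
    ¬ genMinors K m n (u+1) 1 m 2 (u+2) ≤ genMinors K m n (u+2) 1 m 1 (u+3) := by
  intro hle
  let r : Fin (u+1) → Fin m := fun i => ⟨i.val, by omega⟩
  let c : Fin (u+1) → Fin n := fun i => ⟨i.val + 1, by omega⟩
  have hr : StrictMono r := fun i j h => h
  have hc : StrictMono c := by
    intro i j h
    rw [Fin.lt_def] at h ⊢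
    simp only [c]
    omega
  have hmem : minor K r c ∈ genMinors K m n (u+1) 1 m 2 (u+2) := by
    rw [genMinors_eq_span]
    refine Ideal.subset_span ⟨r, c, hr, hc, fun j => ?_, rfl⟩
    simp only [c, Win]
    omega
  obtain ⟨r', c', hr', hc', hW', hT'⟩ := genMinors_lead _ (hle hmem) (minor_ne_zero K r c hr hc)
  rw [(minor_degree K r c hr hc).1] at hT'
  obtain ⟨i, hi⟩ := pm_ne _ _ _ (hT' 0)
  obtain ⟨j, hj⟩ := pm_ne _ _ _ (hT' (Fin.last (u+1)))
  have h1 := congrArg (fun p => p.2.val) hi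
  have h2 := congrArg (fun p => p.2.val) hj
  have h5 := sm_gap c' hc' (u+1) 0 (Fin.last (u+1)) (by simp)
  simp only [c] at h1 h2
  omega

lemma minimalPrimes_inf {R : Type*} [CommRing R] (P Q : Ideal R) (hP : P.IsPrime) (hQ : Q.IsPrime)
    (h1 : ¬ P ≤ Q) (h2 : ¬ Q ≤ P) : (P ⊓ Q).minimalPrimes = {P, Q} := by
  ext I
  simp only [Set.mem_insert_iff, Set.mem_singleton_iff]
  constructor
  · rintro ⟨⟨hI, hle⟩, hmin⟩
    rcases hI.inf_le.1 hle with h | h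
    · exact Or.inl (le_antisymm (hmin ⟨hP, inf_le_left⟩ h) h)
    · exact Or.inr (le_antisymm (hmin ⟨hQ, inf_le_right⟩ h) h)
  · rintro (rfl | rfl)
    · refine ⟨⟨hP, inf_le_left⟩, ?_⟩
      rintro J ⟨hJ, hle⟩ hJP
      rcases hJ.inf_le.1 hle with h | h
      · exact h
      · exact absurd (h.trans hJP) h2
    · refine ⟨⟨hQ, inf_le_right⟩, ?_⟩
      rintro J ⟨hJ, hle⟩ hJP
      rcases hJ.inf_le.1 hle with h | h
      · exact absurd (h.trans hJP) h1
      · exact h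

end AdjMinors

/-- `I_t(X_{[1,t]}) + I_t(X_{[2,t+1]}) = I_t(X_{[1,t+1]}) ∩ I_{t-1}(X_{[2,t]})`,
and this is the minimal prime decomposition: `I_t(X_{[1,t+1]})` and `I_{t-1}(X_{[2,t]})`
are exactly the minimal primes of the left-hand side. -/
theorem sum_adjacent_minors_decomposition (K : Type*) [Field K] (m n : ℕ)
    (hm : 0 < m) (hmn : m ≤ n) (t : ℕ) (ht2 : 2 ≤ t) (htm : t ≤ m) (htn : t + 1 ≤ n) :
    genMinors K m n t 1 m 1 t + genMinors K m n t 1 m 2 (t + 1)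
      = genMinors K m n t 1 m 1 (t + 1) ⊓ genMinors K m n (t - 1) 1 m 2 t
    ∧ (genMinors K m n t 1 m 1 t + genMinors K m n t 1 m 2 (t + 1)).minimalPrimes
      = {genMinors K m n t 1 m 1 (t + 1), genMinors K m n (t - 1) 1 m 2 t} := by
  obtain ⟨u, rfl⟩ : ∃ u, t = u + 2 := ⟨t - 2, by omega⟩
  have h := AdjMinors.sum_eq_inf K m n u
  refine ⟨h, ?_⟩
  have h' : genMinors K m n (u + 2) 1 m 1 (u + 2) + genMinors K m n (u + 2) 1 m 2 (u + 2 + 1)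
      = genMinors K m n (u + 2) 1 m 1 (u + 2 + 1) ⊓ genMinors K m n (u + 2 - 1) 1 m 2 (u + 2) := h
  rw [h']
  exact AdjMinors.minimalPrimes_inf _ _ (AdjMinors.genMinors_prime K m n (u + 1) 1 (u + 3))
    (AdjMinors.genMinors_prime K m n u 2 (u + 2)) (AdjMinors.not_le_one K m n u htm htn)
    (AdjMinors.not_le_two K m n u htm htn)
end

section
/- Let K be a field, m ≤ n positive integers, X the m×n generic matrix over S = K[x_{ij}], and t an integer with 2 ≤ t ≤ m and t + 2 ≤ n. Then I_t(X_{[1,t+1]}) + I_t(X_{[2,t+2]}) = I_t(X_{[1,t+2]}) ∩ I_{t−1}(X_{[2,t+1]}) as ideals of S. -/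
namespace AdjMinors
open MvPolynomial

section rank
variable {L : Type*} [Field L] {m n : ℕ}

/-- column `c` of `x`, truncated to the rows `< k` -/
def colv (x : Fin m × Fin n → L) (k : ℕ) (c : Fin n) : Fin m → L :=
  fun i => if i.val < k then x (i, c) else 0

/-- span of the columns `lo ≤ c < j`, truncated to the rows `< k` -/
def W (lo : ℕ) (x : Fin m × Fin n → L) (k j : ℕ) : Submodule L (Fin m → L) :=
  Submodule.span L {v | ∃ c : Fin n, lo ≤ c.val ∧ c.val < j ∧ v = colv x k c}

noncomputable def rk (lo : ℕ) (x : Fin m × Fin n → L) (k j : ℕ) : ℕ :=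
  Module.finrank L (W lo x k j)

/-- the monomial `u` contains a strict diagonal chain of length `l` -/
def Chain (lo : ℕ) (u : Fin m × Fin n →₀ ℕ) (k j l : ℕ) : Prop :=
  ∃ (a : Fin l → Fin m) (b : Fin l → Fin n), StrictMono a ∧ StrictMono b ∧
    ∀ i, (a i).val < k ∧ lo ≤ (b i).val ∧ (b i).val < j ∧ u (a i, b i) ≠ 0

theorem W_le {lo : ℕ} {x : Fin m × Fin n → L} {k j : ℕ} {U : Submodule L (Fin m → L)}
    (h : ∀ c : Fin n, lo ≤ c.val → c.val < j → colv x k c ∈ U) : W lo x k j ≤ U := by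
  apply Submodule.span_le.2
  rintro _ ⟨c, h1, h2, rfl⟩
  exact h c h1 h2

theorem colv_mem {lo : ℕ} {x : Fin m × Fin n → L} {k j : ℕ} {c : Fin n}
    (h1 : lo ≤ c.val) (h2 : c.val < j) : colv x k c ∈ W lo x k j :=
  Submodule.subset_span ⟨c, h1, h2, rfl⟩

theorem W_congr {lo : ℕ} {x y : Fin m × Fin n → L} {k j : ℕ}
    (h : ∀ (i : Fin m) (c : Fin n), i.val < k → lo ≤ c.val → c.val < j → x (i, c) = y (i, c)) :
    W lo x k j = W lo y k j := by
  have : ∀ c : Fin n, lo ≤ c.val → c.val < j → colv x k c = colv y k c := by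
    intro c h1 h2
    funext i
    unfold colv
    split_ifs with hi
    · exact h i c hi h1 h2
    · rfl
  apply le_antisymm
  · exact W_le fun c h1 h2 => by rw [this c h1 h2]; exact colv_mem h1 h2
  · exact W_le fun c h1 h2 => by rw [← this c h1 h2]; exact colv_mem h1 h2

theorem rk_le_of_le {lo : ℕ} {x : Fin m × Fin n → L} {k j : ℕ} {U : Submodule L (Fin m → L)}
    (h : W lo x k j ≤ U) : rk lo x k j ≤ Module.finrank L U :=
  Submodule.finrank_mono h

/-- truncation -/
def trunc (L : Type*) [Field L] (m k : ℕ) : (Fin m → L) →ₗ[L] (Fin m → L) where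
  toFun v := fun i => if i.val < k then v i else 0
  map_add' v w := by funext i; simp only [Pi.add_apply]; split_ifs <;> simp
  map_smul' a v := by funext i; simp

theorem trunc_colv (x : Fin m × Fin n → L) (k : ℕ) (c : Fin n) :
    trunc L m k (colv x (k + 1) c) = colv x k c := by
  funext i
  simp only [trunc, colv, LinearMap.coe_mk, AddHom.coe_mk]
  by_cases h : i.val < k
  · simp [h, Nat.lt_succ_of_lt h]
  · simp [h]

theorem W_eq_map (lo : ℕ) (x : Fin m × Fin n → L) (k j : ℕ) :
    W lo x k j = (W lo x (k + 1) j).map (trunc L m k) := by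
  apply le_antisymm
  · refine W_le fun c h1 h2 => ?_
    exact ⟨_, colv_mem h1 h2, trunc_colv x k c⟩
  · rw [Submodule.map_le_iff_le_comap]
    refine W_le fun c h1 h2 => ?_
    rw [Submodule.mem_comap, trunc_colv]
    exact colv_mem h1 h2

theorem rk_le_succ (lo : ℕ) (x : Fin m × Fin n → L) (k j : ℕ) :
    rk lo x k j ≤ rk lo x (k + 1) j := by
  unfold rk
  rw [W_eq_map]
  exact Submodule.finrank_map_le _ _

theorem finrank_sup_span_le (U : Submodule L (Fin m → L)) (w : Fin m → L) :
    Module.finrank L (U ⊔ Submodule.span L {w} : Submodule L (Fin m → L))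
      ≤ Module.finrank L U + 1 := by
  have h1 := Submodule.finrank_add_le_finrank_add_finrank U (Submodule.span L {w})
  have h2 : Module.finrank L (Submodule.span L {w}) ≤ 1 := by
    have := finrank_span_finset_le_card (R := L) ({w} : Finset (Fin m → L))
    rw [Set.finrank, Finset.coe_singleton, Finset.card_singleton] at this
    exact this
  omega

/-- the deformed matrix -/
def curve (lo : ℕ) (x : Fin m × Fin n → L) (κ : Fin m) (π : Fin n) (s : L) :
    Fin m × Fin n → L := fun ij =>
  if ij = (κ, π) then s⁻¹ else
    if ij.1.val < κ.val ∧ lo ≤ ij.2.val ∧ ij.2.val < π.val then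
      x ij + s * (x (κ, ij.2) * x (ij.1, π)) else x ij

theorem curve_col_lt (lo : ℕ) (x : Fin m × Fin n → L) (κ : Fin m) (π : Fin n) (s : L)
    (c : Fin n) (h1 : lo ≤ c.val) (h2 : c.val < π.val) :
    colv (curve lo x κ π s) κ c = colv x κ c + (s * x (κ, c)) • colv x κ π := by
  funext i
  have : c ≠ π := by rintro rfl; omega
  by_cases h : i.val < κ.val
  · simp [colv, curve, h, h1, h2, this]; ring
  · simp [colv, h]

theorem curve_col_ge (lo : ℕ) (x : Fin m × Fin n → L) (κ : Fin m) (π : Fin n) (s : L)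
    (c : Fin n) (h2 : π.val ≤ c.val) :
    colv (curve lo x κ π s) κ c = colv x κ c := by
  funext i
  by_cases h : i.val < κ.val
  · have : i ≠ κ := by rintro rfl; omega
    have h3 : ¬ c.val < π.val := by omega
    simp only [colv, curve, h, this, Prod.mk.injEq, false_and, if_false, h3, and_false]
  · simp [colv, h]

/-- the row operation behind `curve` -/
def rowop (κ : Fin m) (w : Fin m → L) : (Fin m → L) →ₗ[L] (Fin m → L) where
  toFun v := v + v κ • w
  map_add' v w := by simp only [Pi.add_apply, add_smul]; abel
  map_smul' a v := by simp [smul_smul]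

theorem curve_col_succ (lo : ℕ) (x : Fin m × Fin n → L) (κ : Fin m) (π : Fin n) (s : L)
    (c : Fin n) (h1 : lo ≤ c.val) (h2 : c.val < π.val) :
    colv (curve lo x κ π s) (κ + 1) c = rowop κ (s • colv x κ π) (colv x (κ + 1) c) := by
  funext i
  have : c ≠ π := by rintro rfl; omega
  simp only [rowop, LinearMap.coe_mk, AddHom.coe_mk, Pi.add_apply, Pi.smul_apply, smul_eq_mul]
  by_cases h : i.val < κ.val
  · simp [colv, curve, h, h1, h2, this, Nat.lt_succ_of_lt h]; ring
  · by_cases h' : i.val < κ.val + 1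
    · simp [colv, curve, h, h', this]
    · simp [colv, h, h']

theorem curve_col_succ' (lo : ℕ) (x : Fin m × Fin n → L) (κ : Fin m) (π : Fin n) (s : L)
    (hs : s ≠ 0) (c : Fin n) (h1 : lo ≤ c.val) (h2 : c.val < π.val) :
    colv (curve lo x κ π s) (κ + 1) c =
      colv x κ c + (s * x (κ, c)) • colv (curve lo x κ π s) (κ + 1) π := by
  funext i
  have : c ≠ π := by rintro rfl; omega
  simp only [Pi.add_apply, Pi.smul_apply, smul_eq_mul]
  by_cases h : i.val < κ.val
  · have h4 : i ≠ κ := by rintro rfl; omega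
    simp [colv, curve, h, h1, h2, h4, this, Nat.lt_succ_of_lt h]; ring
  · by_cases h' : i.val < κ.val + 1
    · have h4 : i = κ := by ext; omega
      subst h4
      simp [colv, curve, this]
      field_simp
    · simp [colv, h, h']

theorem curve_mem (lo hi : ℕ) (x : Fin m × Fin n → L) (κ : Fin m) (π : Fin n) (s : L)
    (hs : s ≠ 0) (r r' : ℕ → ℕ) (hlo : lo ≤ π.val) (hhi : π.val + 1 ≤ hi)
    (hinv : ∀ j ≤ π.val + 1, r' j = r j ∨ r' (π.val + 1) ≤ r' j)
    (h1 : ∀ j ≤ hi, rk lo x κ j ≤ r' j) (h2 : ∀ j ≤ π.val, rk lo x (κ + 1) j ≤ r j)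
    (h3 : rk lo x κ π + 1 ≤ r (π + 1)) :
    (∀ j ≤ hi, rk lo (curve lo x κ π s) κ j ≤ r' j) ∧
      (∀ j ≤ π.val + 1, rk lo (curve lo x κ π s) (κ + 1) j ≤ r j) := by
  have A : ∀ j ≤ π.val, rk lo (curve lo x κ π s) (κ + 1) j ≤ r j := by
    intro j hj
    have : W lo (curve lo x κ π s) (κ + 1) j ≤
        (W lo x (κ + 1) j).map (rowop κ (s • colv x κ π)) := by
      refine W_le fun c hc1 hc2 => ?_
      rw [curve_col_succ lo x κ π s c hc1 (by omega)]
      exact ⟨_, colv_mem hc1 hc2, rfl⟩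
    exact ((rk_le_of_le this).trans (Submodule.finrank_map_le _ _)).trans (h2 j hj)
  have B : ∀ j j', π.val + 1 ≤ j' → j ≤ j' →
      W lo (curve lo x κ π s) κ j ≤ W lo x κ j' := by
    intro j j' hj hjj
    refine W_le fun c hc1 hc2 => ?_
    by_cases hc : c.val < π.val
    · rw [curve_col_lt lo x κ π s c hc1 hc]
      exact add_mem (colv_mem hc1 (by omega)) (Submodule.smul_mem _ _ (colv_mem hlo (by omega)))
    · rw [curve_col_ge lo x κ π s c (by omega)]
      exact colv_mem hc1 (by omega)
  refine ⟨fun j hj => ?_, fun j hj => ?_⟩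
  · by_cases hjp : j ≤ π.val
    · rcases hinv j (by omega) with h | h
      · rw [h]
        exact (rk_le_succ _ _ _ _).trans (A j hjp)
      · exact ((rk_le_of_le (B j (π + 1) le_rfl (by omega))).trans (h1 _ hhi)).trans h
    · exact (rk_le_of_le (B j j (by omega) le_rfl)).trans (h1 j hj)
  · rcases Nat.lt_or_ge π.val j with hjp | hjp
    · have hj' : j = π.val + 1 := by omega
      subst hj'
      refine le_trans ?_ h3
      refine le_trans (rk_le_of_le (U := W lo x κ π ⊔
        Submodule.span L {colv (curve lo x κ π s) (κ + 1) π}) ?_) (finrank_sup_span_le _ _)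
      refine W_le fun c hc1 hc2 => ?_
      have hw : colv (curve lo x κ π s) (κ + 1) π ∈ W lo x κ π ⊔
          Submodule.span L {colv (curve lo x κ π s) (κ + 1) π} :=
        Submodule.mem_sup_right (Submodule.mem_span_singleton_self _)
      by_cases hc : c.val < π.val
      · rw [curve_col_succ' lo x κ π s hs c hc1 hc]
        exact add_mem (Submodule.mem_sup_left (colv_mem hc1 hc)) (Submodule.smul_mem _ _ hw)
      · have : c = π := by ext; omega
        rw [this]; exact hw
    · exact A j hjp

end rank

section limit
variable {L : Type*} [Field L] {σ : Type*}

/-- the part of `f` of degree `d` in the variable `c` -/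
noncomputable def part (f : MvPolynomial σ L) (c : σ) (d : ℕ) : MvPolynomial σ L :=
  ∑ u ∈ f.support with u c = d, monomial u (coeff u f)

theorem coeff_part (f : MvPolynomial σ L) (c : σ) (d : ℕ) (w : σ →₀ ℕ) :
    coeff w (part f c d) = if w c = d then coeff w f else 0 := by
  classical
  unfold part
  rw [coeff_sum]
  simp only [coeff_monomial]
  rw [Finset.sum_ite_eq']
  by_cases h : coeff w f = 0
  · simp [h]
  · simp [h]

theorem eval_part_zero [Infinite L] (f : MvPolynomial σ L) (c : σ) (d : ℕ)
    (hd : ∀ u ∈ f.support, u c ≤ d) (q : σ → Polynomial L)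
    (h : ∀ s : L, s ≠ 0 → ∀ y : σ → L, (y c = s⁻¹) → (∀ i, i ≠ c → y i = (q i).eval s) →
      eval y f = 0) (x : σ → L) (hx : ∀ i, i ≠ c → x i = (q i).eval 0) :
    eval x (part f c d) = 0 := by
  classical
  set G : Polynomial L := ∑ u ∈ f.support, Polynomial.C (coeff u f) * Polynomial.X ^ (d - u c) *
    ∏ i ∈ u.support.erase c, (q i) ^ (u i) with hG
  have key : ∀ (y : σ → L) (u : σ →₀ ℕ), ∏ i ∈ u.support, y i ^ u i =
      y c ^ (u c) * ∏ i ∈ u.support.erase c, y i ^ u i := by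
    intro y u
    by_cases hc : c ∈ u.support
    · rw [Finset.mul_prod_erase _ (fun i => y i ^ u i) hc]
    · rw [Finset.erase_eq_of_notMem hc, Finsupp.notMem_support_iff.1 hc]; simp
  have hG0 : G = 0 := by
    apply Polynomial.eq_zero_of_infinite_isRoot
    refine Set.Infinite.mono (s := {0}ᶜ) ?_ (Set.Finite.infinite_compl (Set.finite_singleton 0))
    intro s hs
    have hs : s ≠ 0 := hs
    have h0 := h s hs (fun i => if i = c then s⁻¹ else (q i).eval s) (by simp)
      (fun i hi => by simp [hi])
    change Polynomial.eval s G = 0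
    rw [eval_eq] at h0
    have : Polynomial.eval s G = s ^ d * 0 := by
      rw [← h0, hG, Polynomial.eval_finsetSum, Finset.mul_sum]
      refine Finset.sum_congr rfl fun u hu => ?_
      rw [key]
      have e1 : ∏ i ∈ u.support.erase c, (if i = c then s⁻¹ else (q i).eval s) ^ u i =
          ∏ i ∈ u.support.erase c, ((q i).eval s) ^ u i :=
        Finset.prod_congr rfl fun i hi => by rw [if_neg (Finset.ne_of_mem_erase hi)]
      rw [e1]
      simp only [Polynomial.eval_mul, Polynomial.eval_C, Polynomial.eval_pow, Polynomial.eval_X,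
        Polynomial.eval_prod, if_true]
      have e2 : s ^ d * (s⁻¹) ^ u c = s ^ (d - u c) := by
        rw [inv_pow, pow_sub₀ _ hs (hd u hu)]
      rw [← e2]; ring
    rw [this, mul_zero]
  have h1 : Polynomial.eval 0 G = 0 := by rw [hG0]; simp
  have h2 : eval x (part f c d) = x c ^ d * Polynomial.eval 0 G := by
    rw [hG, Polynomial.eval_finsetSum, Finset.mul_sum, part, map_sum, Finset.sum_filter]
    refine Finset.sum_congr rfl fun u hu => ?_
    simp only [Polynomial.eval_mul, Polynomial.eval_C, Polynomial.eval_pow, Polynomial.eval_X,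
        Polynomial.eval_prod]
    split_ifs with hud
    · rw [eval_monomial, Finsupp.prod, key, hud]
      have e1 : ∏ i ∈ u.support.erase c, x i ^ u i =
          ∏ i ∈ u.support.erase c, ((q i).eval 0) ^ u i :=
        Finset.prod_congr rfl fun i hi => by rw [hx i (Finset.ne_of_mem_erase hi)]
      rw [e1]; simp; ring
    · have : d - u c ≠ 0 := by have := hd u hu; omega
      rw [zero_pow this]; simp
  rw [h2, h1, mul_zero]

end limit

section main
variable {L : Type*} [Field L] {m n : ℕ}

theorem rk_eq_zero (lo : ℕ) (x : Fin m × Fin n → L) (k j : ℕ) (h : j ≤ lo) : rk lo x k j = 0 := by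
  have : W lo x k j = ⊥ := by
    rw [eq_bot_iff]
    exact W_le fun c h1 h2 => by omega
  rw [rk, this, finrank_bot]

theorem Chain.snoc {lo : ℕ} {u : Fin m × Fin n →₀ ℕ} {κ : Fin m} {π : Fin n} {j l : ℕ}
    (h : Chain lo u κ j l) (hj : j ≤ π.val) (hlo : lo ≤ π.val) (hu : u (κ, π) ≠ 0) :
    Chain lo u (κ + 1) (π + 1) (l + 1) := by
  obtain ⟨a, b, ha, hb, hab⟩ := h
  refine ⟨Fin.snoc (α := fun _ => Fin m) a κ, Fin.snoc (α := fun _ => Fin n) b π, ?_, ?_, ?_⟩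
  · intro i i' hii
    induction i' using Fin.lastCases with
    | last =>
      induction i using Fin.lastCases with
      | last => exact absurd hii (lt_irrefl _)
      | cast i =>
        simp only [Fin.snoc_last, Fin.snoc_castSucc]
        exact (hab i).1
    | cast i' =>
      induction i using Fin.lastCases with
      | last => exact absurd hii (by simp [Fin.le_last])
      | cast i =>
        simp only [Fin.snoc_castSucc]
        exact ha (by simpa using hii)
  · intro i i' hii
    induction i' using Fin.lastCases with
    | last =>
      induction i using Fin.lastCases with
      | last => exact absurd hii (lt_irrefl _)
      | cast i =>
        simp only [Fin.snoc_last, Fin.snoc_castSucc]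
        exact Fin.lt_def.2 (lt_of_lt_of_le (hab i).2.2.1 hj)
    | cast i' =>
      induction i using Fin.lastCases with
      | last => exact absurd hii (by simp [Fin.le_last])
      | cast i =>
        simp only [Fin.snoc_castSucc]
        exact hb (by simpa using hii)
  · intro i
    induction i using Fin.lastCases with
    | last => simpa using ⟨hlo, hu⟩
    | cast i =>
      simp only [Fin.snoc_castSucc]
      obtain ⟨h1, h2, h3, h4⟩ := hab i
      exact ⟨by omega, h2, by omega, h4⟩

theorem Chain.nil (lo : ℕ) (u : Fin m × Fin n →₀ ℕ) (k j : ℕ) : Chain lo u k j 0 :=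
  ⟨Fin.elim0, Fin.elim0, fun i => i.elim0, fun i => i.elim0, fun i => i.elim0⟩

theorem part_vanish [Infinite L] (lo hi : ℕ) (κ : Fin m) (π : Fin n) (r r' : ℕ → ℕ)
    (f : MvPolynomial (Fin m × Fin n) L) (d : ℕ) (hd : ∀ u ∈ f.support, u (κ, π) ≤ d)
    (hlo : lo ≤ π.val) (hhi : π.val + 1 ≤ hi)
    (hinv : ∀ j ≤ π.val + 1, r' j = r j ∨ r' (π.val + 1) ≤ r' j)
    (hvan : ∀ x : Fin m × Fin n → L, (∀ j ≤ hi, rk lo x κ j ≤ r' j) →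
      (∀ j ≤ π.val + 1, rk lo x (κ + 1) j ≤ r j) → eval x f = 0)
    (x : Fin m × Fin n → L)
    (h1 : ∀ j ≤ hi, rk lo x κ j ≤ r' j) (h2 : ∀ j ≤ π.val, rk lo x (κ + 1) j ≤ r j)
    (h3 : rk lo x κ π + 1 ≤ r (π + 1)) : eval x (part f (κ, π) d) = 0 := by
  refine eval_part_zero f (κ, π) d hd (fun ij =>
    if ij.1.val < κ.val ∧ lo ≤ ij.2.val ∧ ij.2.val < π.val then
      Polynomial.C (x ij) + Polynomial.X * Polynomial.C (x (κ, ij.2) * x (ij.1, π))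
      else Polynomial.C (x ij)) ?_ x ?_
  · intro s hs y hy1 hy2
    have hy : y = curve lo x κ π s := by
      funext ij
      by_cases hij : ij = (κ, π)
      · rw [hij, hy1]; simp [curve]
      · rw [hy2 ij hij]
        simp only [curve, if_neg hij]
        split_ifs <;> simp
    obtain ⟨c1, c2⟩ := curve_mem lo hi x κ π s hs r r' hlo hhi hinv h1 h2 h3
    rw [hy]
    exact hvan _ c1 c2
  · intro ij hij
    split_ifs <;> simp

theorem row_step [Infinite L] (lo hi : ℕ) (hn : hi ≤ n) (κ : Fin m)
    (IH : ∀ (r : ℕ → ℕ) (f : MvPolynomial (Fin m × Fin n) L), Monotone r →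
      (∀ u ∈ f.support, ∀ j ≤ hi, ∀ l, Chain lo u κ j l → l ≤ r j) →
      (∀ x : Fin m × Fin n → L, (∀ j ≤ hi, rk lo x κ j ≤ r j) → eval x f = 0) → f = 0) :
    ∀ p ≤ hi, ∀ (r r' : ℕ → ℕ) (f : MvPolynomial (Fin m × Fin n) L), Monotone r → Monotone r' →
      (∀ j, r' j ≤ r j) → (∀ j ≤ p, r' j = r j ∨ r' p ≤ r' j) →
      (∀ u ∈ f.support, ∀ j ≤ hi, ∀ l, Chain lo u κ j l → l ≤ r' j) →
      (∀ u ∈ f.support, ∀ j ≤ p, ∀ l, Chain lo u (κ + 1) j l → l ≤ r j) →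
      (∀ x : Fin m × Fin n → L, (∀ j ≤ hi, rk lo x κ j ≤ r' j) →
        (∀ j ≤ p, rk lo x (κ + 1) j ≤ r j) → eval x f = 0) → f = 0 := by
  have base : ∀ p ≤ lo, ∀ (r r' : ℕ → ℕ) (f : MvPolynomial (Fin m × Fin n) L), Monotone r' →
      (∀ u ∈ f.support, ∀ j ≤ hi, ∀ l, Chain lo u κ j l → l ≤ r' j) →
      (∀ x : Fin m × Fin n → L, (∀ j ≤ hi, rk lo x κ j ≤ r' j) →
        (∀ j ≤ p, rk lo x (κ + 1) j ≤ r j) → eval x f = 0) → f = 0 := by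
    intro p hp r r' f hr' hs hv
    refine IH r' f hr' hs fun x hx => hv x hx fun j hj => ?_
    rw [rk_eq_zero _ _ _ _ (hj.trans hp)]
    exact Nat.zero_le _
  intro p
  induction p with
  | zero =>
    intro _ r r' f _ hr' _ _ hs _ hv
    exact base 0 (Nat.zero_le _) r r' f hr' hs hv
  | succ p ih =>
    intro hp r r' f hr hr' hrr hinv hs hs2 hv
    by_cases hlo : lo ≤ p
    swap
    · exact base (p + 1) (by omega) r r' f hr' hs hv
    have ih := ih (by omega)
    obtain ⟨π, hπ⟩ : ∃ π : Fin n, π.val = p := ⟨⟨p, by omega⟩, rfl⟩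
    by_contra hf
    obtain ⟨u₀, hu₀, hmax⟩ := Finset.exists_max_image f.support (fun u => u (κ, π))
      (by rwa [Finset.nonempty_iff_ne_empty, Ne, support_eq_empty])
    set d := u₀ (κ, π) with hd
    have hvpart := part_vanish lo hi κ π r r' f d hmax (by omega) (by omega)
      (by rw [hπ]; exact hinv) (by rw [hπ]; exact hv)
    have hsub : ∀ u ∈ (part f (κ, π) d).support, u ∈ f.support ∧ u (κ, π) = d := by
      intro u hu
      rw [mem_support_iff, coeff_part] at hu
      split_ifs at hu with h
      · exact ⟨mem_support_iff.2 hu, h⟩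
      · exact absurd rfl hu
    have hpne : part f (κ, π) d ≠ 0 := by
      intro h0
      have := coeff_part f (κ, π) d u₀
      rw [h0, if_pos rfl, coeff_zero] at this
      exact mem_support_iff.1 hu₀ this.symm
    by_cases hd0 : d = 0
    · -- `f` does not involve the variable
      have hpf : part f (κ, π) d = f := by
        ext u
        rw [coeff_part]
        split_ifs with h
        · rfl
        · by_contra hne
          have := hmax u (mem_support_iff.2 (Ne.symm hne))
          omega
      rw [hpf] at hvpart
      refine hf (ih r r' f hr hr' hrr ?_ hs (fun u hu j hj => hs2 u hu j (by omega)) ?_)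
      · intro j hj
        rcases hinv j (by omega) with h | h
        · exact Or.inl h
        · exact Or.inr ((hr' (Nat.le_succ p)).trans h)
      · intro x h1 h2
        by_cases hmem : colv x κ π ∈ W lo x κ p
        · rw [W_eq_map] at hmem
          obtain ⟨w, hw, hwe⟩ := hmem
          have hwz : ∀ i : Fin m, κ.val < i.val → w i = 0 := by
            intro i hi'
            have hle : W lo x (κ + 1) p ≤ LinearMap.ker (LinearMap.proj (R := L) (φ := fun _ : Fin m => L) i) := by
              refine W_le fun c _ _ => ?_
              have : ¬ i.val < κ.val + 1 := by omega
              simp [colv, this]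
            simpa using hle hw
          set y : Fin m × Fin n → L := Function.update x (κ, π) (w κ) with hy
          have hyne : ∀ ij, ij ≠ (κ, π) → y ij = x ij := fun ij h => by
            rw [hy, Function.update_of_ne h]
          have hyf : eval y f = eval x f := by
            rw [eval_eq, eval_eq]
            refine Finset.sum_congr rfl fun u hu => ?_
            congr 1
            refine Finset.prod_congr rfl fun ij hij => ?_
            rw [hyne]
            rintro rfl
            have := hmax u hu
            exact (Finsupp.mem_support_iff.1 hij) (by omega)
          rw [← hyf]
          have hk : ∀ j, rk lo y κ j = rk lo x κ j := by
            intro j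
            rw [rk, rk, W_congr]
            intro i c hi' _ _
            apply hyne
            intro h
            rw [(Prod.mk.inj h).1] at hi'
            exact lt_irrefl _ hi'
          have hW : ∀ j ≤ p, W lo y (κ + 1) j = W lo x (κ + 1) j := by
            intro j hj
            apply W_congr
            intro i c _ _ hc
            apply hyne
            intro h
            rw [(Prod.mk.inj h).2] at hc
            omega
          refine hv y (fun j hj => by rw [hk]; exact h1 j hj) fun j hj => ?_
          by_cases hjp : j ≤ p
          · rw [rk, hW j hjp]; exact h2 j hjp
          · have hj' : j = p + 1 := by omega
            subst hj'
            refine le_trans ?_ ((h2 p le_rfl).trans (hr (Nat.le_succ p)))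
            refine rk_le_of_le (W_le fun c hc1 hc2 => ?_)
            by_cases hc : c.val < p
            · rw [← hW p le_rfl]
              exact colv_mem hc1 hc
            · have : c = π := by ext; omega
              subst this
              have : colv y (κ + 1) c = w := by
                funext i
                simp only [colv]
                have e := congrFun hwe i
                simp only [trunc, colv, LinearMap.coe_mk, AddHom.coe_mk] at e
                rcases lt_trichotomy i.val κ.val with h | h | h
                · rw [if_pos (by omega), hyne]
                  · simpa [h] using e.symm
                  · intro h'
                    rw [(Prod.mk.inj h').1] at h
                    exact lt_irrefl _ h
                · have : i = κ := by ext; exact h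
                  subst this
                  simp [hy]
                · rw [if_neg (by omega), hwz i h]
              rw [this]
              exact hw
        · refine hvpart x h1 (by rw [hπ]; exact h2) ?_
          rw [hπ]
          have hlt : W lo x κ p < W lo x κ (p + 1) := by
            refine lt_of_le_of_ne (W_le fun c hc1 hc2 => colv_mem hc1 (by omega)) ?_
            intro he
            rw [he] at hmem
            exact hmem (colv_mem (by omega) (by omega))
          have := Submodule.finrank_lt_finrank_of_lt hlt
          have h4 := h1 (p + 1) hp
          have h5 := hrr (p + 1)
          unfold rk at h4 ⊢
          omega
    · -- leading coefficient
      have hrp : 1 ≤ r (p + 1) := by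
        refine hs2 u₀ hu₀ (p + 1) le_rfl 1 ?_
        have := (Chain.nil lo u₀ κ p).snoc (π := π) hπ.ge (by omega) hd0
        rwa [hπ] at this
      set r'' : ℕ → ℕ := fun j => if j ≤ p then min (r' j) (r (p + 1) - 1) else r' j with hr''
      have hle : ∀ j, r'' j ≤ r' j := by
        intro j
        simp only [hr'']
        split_ifs
        · exact min_le_left _ _
        · exact le_rfl
      refine hpne (ih r r'' _ hr ?_ (fun j => (hle j).trans (hrr j)) ?_ ?_ ?_ ?_)
      · intro a b hab
        have := hr' hab
        simp only [hr'']
        split_ifs <;> omega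
      · intro j hj
        have e1 := hinv j (by omega)
        have e2 := hr' (Nat.le_succ p)
        simp only [hr'', hj, le_refl, if_true]
        simp only [Nat.succ_eq_add_one] at e2
        omega
      · intro u hu j hj l hc
        obtain ⟨huf, hud⟩ := hsub u hu
        have e1 := hs u huf j hj l hc
        simp only [hr'']
        split_ifs with hjp
        · have := hs2 u huf (p + 1) le_rfl (l + 1) (by
            have := hc.snoc (π := π) (by omega) (by omega) (by omega)
            rwa [hπ] at this)
          omega
        · exact e1
      · intro u hu j hj
        exact hs2 u (hsub u hu).1 j (by omega)
      · intro x h1 h2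
        refine hvpart x (fun j hj => (h1 j hj).trans (hle j)) (by rw [hπ]; exact h2) ?_
        have := h1 p (by omega)
        simp only [hr'', le_refl, if_true] at this
        rw [hπ]
        omega

theorem std_indep [Infinite L] (lo hi : ℕ) (hn : hi ≤ n) : ∀ k ≤ m, ∀ (r : ℕ → ℕ)
    (f : MvPolynomial (Fin m × Fin n) L), Monotone r →
      (∀ u ∈ f.support, ∀ j ≤ hi, ∀ l, Chain lo u k j l → l ≤ r j) →
      (∀ x : Fin m × Fin n → L, (∀ j ≤ hi, rk lo x k j ≤ r j) → eval x f = 0) → f = 0 := by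
  intro k
  induction k with
  | zero =>
    intro _ r f _ _ hv
    apply MvPolynomial.funext
    intro x
    rw [map_zero]
    refine hv x fun j _ => ?_
    have : W lo x 0 j = ⊥ := by
      rw [eq_bot_iff]
      refine W_le fun c _ _ => ?_
      rw [Submodule.mem_bot]
      funext i
      simp [colv]
    rw [rk, this, finrank_bot]
    exact Nat.zero_le _
  | succ k ih =>
    intro hk r f hr hs hv
    refine row_step lo hi hn ⟨k, hk⟩ (ih (by omega)) hi le_rfl r r f hr hr (fun _ => le_rfl)
      (fun _ _ => Or.inl rfl) ?_ hs ?_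
    · rintro u hu j hj l ⟨a, b, ha, hb, hab⟩
      refine hs u hu j hj l ⟨a, b, ha, hb, fun i => ?_⟩
      obtain ⟨h1, h2⟩ := hab i
      exact ⟨Nat.lt_succ_of_lt h1, h2⟩
    · intro x _ h2
      exact hv x h2

end main

section groebner

/-- row-major order on the cells -/
@[reducible] def cellOrder (m n : ℕ) : LinearOrder (Fin m × Fin n) :=
  LinearOrder.lift' (toLex : Fin m × Fin n → Fin m ×ₗ Fin n) toLex.injective

noncomputable def diagOrd (m n : ℕ) : MonomialOrder (Fin m × Fin n) :=
  @MonomialOrder.lex _ (cellOrder m n)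
    (@Finite.to_wellFoundedGT _ _ (cellOrder m n).toPartialOrder.toPreorder)

theorem diagOrd_lt {m n : ℕ} {u v : Fin m × Fin n →₀ ℕ} (i : Fin m × Fin n)
    (h : ∀ j : Fin m × Fin n, (j.1 < i.1 ∨ j.1 = i.1 ∧ j.2 < i.2) → u j = v j)
    (hi : u i < v i) : (diagOrd m n).toSyn u < (diagOrd m n).toSyn v := by
  refine show @LT.lt (Lex (Fin m × Fin n →₀ ℕ))
    (@Finsupp.instLTLex _ _ _ (cellOrder m n).toLT _) (toLex u) (toLex v) from
    ⟨i, fun j hj => h j ?_, hi⟩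
  have : (toLex j : Fin m ×ₗ Fin n) < toLex i := hj
  rwa [Prod.Lex.toLex_lt_toLex] at this

variable {K : Type*} [Field K] {m n : ℕ}

/-- exponent of a term of the minor -/
noncomputable def dexp {t : ℕ} (r : Fin t → Fin m) (c : Fin t → Fin n) (σ : Equiv.Perm (Fin t)) :
    Fin m × Fin n →₀ ℕ := ∑ i, Finsupp.single (r i, c (σ i)) 1

theorem dexp_lt {t : ℕ} {r : Fin t → Fin m} {c : Fin t → Fin n} (hr : StrictMono r)
    (hc : StrictMono c) (σ : Equiv.Perm (Fin t)) (hσ : σ ≠ 1) :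
    (diagOrd m n).toSyn (dexp r c σ) < (diagOrd m n).toSyn (dexp r c 1) := by
  obtain ⟨i₀, h1, h2⟩ : ∃ i, σ i ≠ i ∧ ∀ j < i, σ j = j := by
    have hex : ∃ i, σ i ≠ i := by
      by_contra h
      push Not at h
      exact hσ (Equiv.ext h)
    obtain ⟨i, hi, hmin⟩ := WellFounded.has_min (wellFounded_lt (α := Fin t)) {i | σ i ≠ i} hex
    refine ⟨i, hi, fun j hj => ?_⟩
    by_contra hne
    exact hmin j hne hj
  have h3 : i₀ < σ i₀ := by
    rcases lt_trichotomy i₀ (σ i₀) with h | h | h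
    · exact h
    · exact absurd h.symm h1
    · exact absurd (σ.injective (h2 _ h)) h1
  refine diagOrd_lt (r i₀, c i₀) ?_ ?_
  · rintro ⟨a, b⟩ hab
    simp only [dexp, Finsupp.finsetSum_apply]
    refine Finset.sum_congr rfl fun i _ => ?_
    simp only [Finsupp.single_apply, Prod.mk.injEq, Equiv.Perm.coe_one, id_eq]
    rcases hab with hab | ⟨hab, hb⟩
    · by_cases hia : r i = a
      · have : i < i₀ := by
          rw [← hia] at hab
          exact hr.lt_iff_lt.1 hab
        rw [h2 i this]
      · simp [hia]
    · simp only at hab hb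
      by_cases hia : r i = a
      · have : i = i₀ := hr.injective (hia.trans hab)
        subst this
        have e1 : c i ≠ b := hb.ne'
        have e2 : c (σ i) ≠ b := (hb.trans (hc h3)).ne'
        simp [e1, e2]
      · simp [hia]
  · have e1 : dexp r c σ (r i₀, c i₀) = 0 := by
      simp only [dexp, Finsupp.finsetSum_apply]
      refine Finset.sum_eq_zero fun i _ => ?_
      rw [Finsupp.single_apply, if_neg]
      intro h
      have e := hr.injective (Prod.mk.inj h).1
      subst e
      exact h1 (hc.injective (Prod.mk.inj h).2)
    have e2 : 0 < dexp r c 1 (r i₀, c i₀) := by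
      simp only [dexp, Finsupp.finsetSum_apply]
      refine Finset.sum_pos' (fun _ _ => Nat.zero_le _) ⟨i₀, Finset.mem_univ _, ?_⟩
      simp
    omega

theorem minor_eq_s5 {t : ℕ} (r : Fin t → Fin m) (c : Fin t → Fin n) :
    Matrix.det (Matrix.of fun i j => (X (r i, c j) : MvPolynomial (Fin m × Fin n) K)) =
      ∑ σ : Equiv.Perm (Fin t), monomial (dexp r c σ) (((Equiv.Perm.sign σ : ℤˣ) : ℤ) : K) := by
  rw [← Matrix.det_transpose, Matrix.det_apply']
  refine Finset.sum_congr rfl fun σ _ => ?_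
  simp only [Matrix.transpose_apply, Matrix.of_apply]
  have : ∏ i, (X (r i, c (σ i)) : MvPolynomial (Fin m × Fin n) K) = monomial (dexp r c σ) 1 := by
    rw [dexp, monomial_sum_one]
    rfl
  rw [this]
  have e : ((((Equiv.Perm.sign σ : ℤˣ) : ℤ)) : MvPolynomial (Fin m × Fin n) K) =
    C ((((Equiv.Perm.sign σ : ℤˣ) : ℤ)) : K) := by simp
  rw [e, C_mul_monomial, mul_one]

theorem minor_lead {t : ℕ} {r : Fin t → Fin m} {c : Fin t → Fin n} (hr : StrictMono r)
    (hc : StrictMono c) :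
    (diagOrd m n).degree
      (Matrix.det (Matrix.of fun i j => (X (r i, c j) : MvPolynomial (Fin m × Fin n) K)))
        = dexp r c 1 ∧
    (diagOrd m n).leadingCoeff
      (Matrix.det (Matrix.of fun i j => (X (r i, c j) : MvPolynomial (Fin m × Fin n) K))) = 1 := by
  classical
  rw [minor_eq_s5]
  set M := ∑ σ : Equiv.Perm (Fin t), monomial (dexp r c σ) (((Equiv.Perm.sign σ : ℤˣ) : ℤ) : K)
    with hM
  have h1 : coeff (dexp r c 1) M = 1 := by
    rw [hM, coeff_sum, Finset.sum_eq_single 1]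
    · simp
    · intro σ _ hσ
      rw [coeff_monomial, if_neg]
      intro h
      have := dexp_lt hr hc σ hσ
      rw [h] at this
      exact lt_irrefl _ this
    · simp
  have h2 : (diagOrd m n).degree M = dexp r c 1 := by
    apply (diagOrd m n).toSyn.injective
    apply le_antisymm
    · rw [MonomialOrder.degree_le_iff]
      intro w hw
      have hw : coeff w M ≠ 0 := mem_support_iff.1 hw
      rw [hM, coeff_sum] at hw
      obtain ⟨σ, _, hσ⟩ := Finset.exists_ne_zero_of_sum_ne_zero hw
      rw [coeff_monomial] at hσ
      split_ifs at hσ with he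
      · subst he
        by_cases h : σ = 1
        · rw [h]
        · exact (dexp_lt hr hc σ h).le
      · exact absurd rfl hσ
    · apply MonomialOrder.le_degree
      rw [mem_support_iff, h1]
      exact one_ne_zero
  exact ⟨h2, by rw [MonomialOrder.leadingCoeff, h2, h1]⟩

theorem dexp_le_iff {t : ℕ} {r : Fin t → Fin m} {c : Fin t → Fin n} (hr : StrictMono r)
    (u : Fin m × Fin n →₀ ℕ) : dexp r c 1 ≤ u ↔ ∀ i, u (r i, c i) ≠ 0 := by
  have key : ∀ i, dexp r c 1 (r i, c i) = 1 := by
    intro i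
    simp only [dexp, Finsupp.finsetSum_apply]
    rw [Finset.sum_eq_single i]
    · simp
    · intro j _ hj
      rw [Finsupp.single_apply, if_neg]
      intro h
      exact hj (hr.injective (Prod.mk.inj h).1)
    · simp
  constructor
  · intro h i
    have := h (r i, c i)
    rw [key] at this
    omega
  · rintro h ⟨a, b⟩
    by_cases hab : ∃ i, (r i, c i) = (a, b)
    · obtain ⟨i, hi⟩ := hab
      rw [← hi, key]
      have := h i
      omega
    · have : dexp r c 1 (a, b) = 0 := by
        simp only [dexp, Finsupp.finsetSum_apply]
        refine Finset.sum_eq_zero fun i _ => ?_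
        rw [Finsupp.single_apply, if_neg]
        intro h'
        exact hab ⟨i, h'⟩
      rw [this]
      exact Nat.zero_le _

theorem Chain.mono_len {lo : ℕ} {u : Fin m × Fin n →₀ ℕ} {k j l t : ℕ} (h : Chain lo u k j l)
    (ht : t ≤ l) : Chain lo u k j t := by
  obtain ⟨a, b, ha, hb, hab⟩ := h
  exact ⟨a ∘ Fin.castLE ht, b ∘ Fin.castLE ht, ha.comp (Fin.strictMono_castLE ht),
    hb.comp (Fin.strictMono_castLE ht), fun i => hab _⟩

/-- the generators -/
def gens (K : Type*) [Field K] (m n t lo hi : ℕ) : Set (MvPolynomial (Fin m × Fin n) K) :=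
  { p | ∃ (r : Fin t → Fin m) (c : Fin t → Fin n),
    StrictMono r ∧ StrictMono c ∧
    (∀ i, 1 ≤ (r i).val + 1 ∧ (r i).val + 1 ≤ m) ∧
    (∀ j, lo + 1 ≤ (c j).val + 1 ∧ (c j).val + 1 ≤ hi) ∧
    p = Matrix.det (Matrix.of fun i j => MvPolynomial.X (r i, c j)) }

theorem gens_lead {t lo hi : ℕ} {b : MvPolynomial (Fin m × Fin n) K} (hb : b ∈ gens K m n t lo hi) :
    IsUnit ((diagOrd m n).leadingCoeff b) := by
  obtain ⟨r, c, hr, hc, _, _, rfl⟩ := hb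
  rw [(minor_lead hr hc).2]
  exact isUnit_one

theorem gens_chain {t lo hi : ℕ} {b : MvPolynomial (Fin m × Fin n) K}
    (hb : b ∈ gens K m n t lo hi) {u : Fin m × Fin n →₀ ℕ} (h : (diagOrd m n).degree b ≤ u) :
    Chain lo u m hi t := by
  obtain ⟨r, c, hr, hc, _, h2, rfl⟩ := hb
  rw [(minor_lead hr hc).1, dexp_le_iff hr] at h
  refine ⟨r, c, hr, hc, fun i => ⟨(r i).2, ?_, ?_, h i⟩⟩
  · have := (h2 i).1; omega
  · have := (h2 i).2; omega

theorem chain_gens (K : Type*) [Field K] {t lo hi : ℕ} {u : Fin m × Fin n →₀ ℕ}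
    (h : Chain lo u m hi t) :
    ∃ b ∈ gens K m n t lo hi, (diagOrd m n).degree b ≤ u := by
  obtain ⟨r, c, hr, hc, h⟩ := h
  refine ⟨_, ⟨r, c, hr, hc, fun i => ⟨by omega, (r i).2⟩, fun i => ⟨?_, ?_⟩, rfl⟩, ?_⟩
  · have := (h i).2.1; omega
  · have := (h i).2.2.1; omega
  · rw [(minor_lead hr hc).1, dexp_le_iff hr]
    exact fun i => (h i).2.2.2

theorem minors_vanish {L : Type*} [Field L] [Algebra K L] {t lo hi : ℕ} (ht : 1 ≤ t)
    {f : MvPolynomial (Fin m × Fin n) K} (hf : f ∈ Ideal.span (gens K m n t lo hi))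
    (x : Fin m × Fin n → L) (hx : rk lo x m hi ≤ t - 1) :
    eval x (map (algebraMap K L) f) = 0 := by
  let φ : MvPolynomial (Fin m × Fin n) K →+* L := (eval x).comp (map (algebraMap K L))
  suffices h : Ideal.span (gens K m n t lo hi) ≤ RingHom.ker φ from h hf
  rw [Ideal.span_le]
  rintro _ ⟨r, c, hr, hc, _, h2, rfl⟩
  change φ _ = 0
  rw [RingHom.map_det]
  by_contra hne
  have hli := Matrix.linearIndependent_cols_of_det_ne_zero hne
  have hli2 : LinearIndependent L (fun j => colv x m (c j)) := by
    refine LinearIndependent.of_comp (LinearMap.funLeft L L r) ?_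
    have e : (⇑(LinearMap.funLeft L L r) ∘ fun j => colv x m (c j)) =
        (φ.mapMatrix (Matrix.of fun i j => X (r i, c j))).col := by
      funext j i
      simp [φ, colv, LinearMap.funLeft, Matrix.col]
    rw [e]
    exact hli
  have e := finrank_span_eq_card hli2
  have hle : Submodule.span L (Set.range fun j => colv x m (c j)) ≤ W lo x m hi := by
    rw [Submodule.span_le]
    rintro _ ⟨j, rfl⟩
    have := h2 j
    exact colv_mem (by omega) (by omega)
  have := Submodule.finrank_mono hle
  rw [e, Fintype.card_fin] at this
  unfold rk at hx
  omega

theorem groebner {t lo hi : ℕ} (ht : 1 ≤ t) (hn : hi ≤ n)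
    {f : MvPolynomial (Fin m × Fin n) K} (hf : f ∈ Ideal.span (gens K m n t lo hi)) (hf0 : f ≠ 0) :
    Chain lo ((diagOrd m n).degree f) m hi t := by
  obtain ⟨g, q, hfq, hdeg, hq⟩ := (diagOrd m n).div_set (B := gens K m n t lo hi)
    (fun b hb => gens_lead hb) f
  have hmem : ∀ b : gens K m n t lo hi, (b : MvPolynomial (Fin m × Fin n) K) ∈
      Ideal.span (gens K m n t lo hi) := fun b => Ideal.subset_span b.2
  have hS : Finsupp.linearCombination _
      (fun (b : gens K m n t lo hi) ↦ (b : MvPolynomial (Fin m × Fin n) K)) g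
        ∈ Ideal.span (gens K m n t lo hi) := by
    rw [Finsupp.linearCombination_apply]
    exact Submodule.sum_mem _ fun b _ => Submodule.smul_mem _ _ (hmem b)
  have hqI : q ∈ Ideal.span (gens K m n t lo hi) := by
    have : q = f - Finsupp.linearCombination _
      (fun (b : gens K m n t lo hi) ↦ (b : MvPolynomial (Fin m × Fin n) K)) g := by
      rw [hfq]; ring
    rw [this]
    exact sub_mem hf hS
  have hq0 : q = 0 := by
    have hinj : Function.Injective (algebraMap K (AlgebraicClosure K)) :=
      (algebraMap K (AlgebraicClosure K)).injective
    apply map_injective _ hinj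
    rw [map_zero]
    refine std_indep lo hi hn m le_rfl (fun _ => t - 1) _ monotone_const ?_ ?_
    · intro u hu j hj l hch
      rw [support_map_of_injective _ hinj] at hu
      by_contra hl
      have hch' := hch.mono_len (t := t) (by omega)
      obtain ⟨a, b, ha, hb, hab⟩ := hch'
      obtain ⟨b, hb, hbu⟩ := chain_gens K (m := m) (n := n) (t := t) (lo := lo) (hi := hi) (u := u)
        ⟨a, b, ha, hb, fun i => ⟨(hab i).1, (hab i).2.1, lt_of_lt_of_le (hab i).2.2.1 hj,
          (hab i).2.2.2⟩⟩
      exact hq u hu b hb hbu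
    · intro x hx
      exact minors_vanish ht hqI x (hx hi le_rfl)
  rw [hq0, add_zero, Finsupp.linearCombination_apply, Finsupp.sum] at hfq
  have hc : coeff ((diagOrd m n).degree f) f ≠ 0 :=
    MonomialOrder.coeff_degree_ne_zero_iff.2 hf0
  nth_rewrite 2 [hfq] at hc
  rw [coeff_sum] at hc
  obtain ⟨b, _, hb⟩ := Finset.exists_ne_zero_of_sum_ne_zero hc
  rw [smul_eq_mul, mul_comm] at hb
  have h1 := (diagOrd m n).le_degree (mem_support_iff.2 hb)
  have h2 : (diagOrd m n).degree f = (diagOrd m n).degree (b.1 * g b) :=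
    (diagOrd m n).toSyn.injective (le_antisymm h1 (hdeg b))
  have hne : b.1 * g b ≠ 0 := by
    intro h0
    rw [h0, coeff_zero] at hb
    exact hb rfl
  rw [MonomialOrder.degree_mul (left_ne_zero_of_mul hne) (right_ne_zero_of_mul hne)] at h2
  exact gens_chain b.2 (by rw [h2]; exact le_self_add)

end groebner

section splice

theorem splice1 {α : Type*} [Preorder α] {T : ℕ} {a : Fin (T + 1) → α} {a' : Fin T → α}
    (ha : StrictMono a) (ha' : StrictMono a') (i : Fin T) (h : a i.castSucc < a' i) :
    StrictMono (fun j : Fin (T + 1) => if h : j.val ≤ i.val then a j else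
      a' ⟨j.val - 1, by omega⟩) := by
  intro j k hjk
  have hjk : j.val < k.val := hjk
  dsimp only
  split_ifs with h1 h2 h2
  · exact ha hjk
  · refine lt_of_le_of_lt (ha.monotone (Fin.le_def.2 ?_)) (lt_of_lt_of_le h
      (ha'.monotone (Fin.le_def.2 ?_)))
    · simpa using h1
    · simp only; omega
  · omega
  · exact ha' (Fin.lt_def.2 (by simp only; omega))

theorem splice2 {α : Type*} [Preorder α] {T : ℕ} {a : Fin (T + 1) → α} {a' : Fin T → α}
    (ha : StrictMono a) (ha' : StrictMono a') (i : Fin T) (h : a' i < a i.succ) :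
    StrictMono (fun j : Fin (T + 1) => if h : j.val ≤ i.val then a' ⟨j.val, by omega⟩ else
      a j) := by
  intro j k hjk
  have hjk : j.val < k.val := hjk
  dsimp only
  split_ifs with h1 h2 h2
  · exact ha' (Fin.lt_def.2 hjk)
  · refine lt_of_le_of_lt (ha'.monotone (Fin.le_def.2 h1)) (lt_of_lt_of_le h
      (ha.monotone (Fin.le_def.2 ?_)))
    simp only [Fin.val_succ]; omega
  · omega
  · exact ha hjk

theorem chain_splice {m n T : ℕ} (hT : 1 ≤ T) {u : Fin m × Fin n →₀ ℕ}
    (hA : Chain 0 u m (T + 3) (T + 1)) (hB : Chain 1 u m (T + 2) T) :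
    Chain 0 u m (T + 2) (T + 1) ∨ Chain 1 u m (T + 3) (T + 1) := by
  obtain ⟨a, b, ha, hb, hab⟩ := hA
  obtain ⟨a', b', ha', hb', hab'⟩ := hB
  by_contra hcon
  push Not at hcon
  obtain ⟨hc1, hc2⟩ := hcon
  have n1 : ∀ i : Fin T, ¬ (a i.castSucc < a' i ∧ b i.castSucc < b' i) := by
    rintro i ⟨h1, h2⟩
    refine hc1 ⟨_, _, splice1 ha ha' i h1, splice1 hb hb' i h2, fun j => ?_⟩
    split_ifs with hj
    · have e := hb.monotone (Fin.le_def.2 (by simpa using hj) : j ≤ i.castSucc)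
      have e2 := (hab' i).2.2.1
      have e : (b j).val ≤ (b i.castSucc).val := e
      have h2 : (b i.castSucc).val < (b' i).val := h2
      exact ⟨(hab j).1, Nat.zero_le _, by omega, (hab j).2.2.2⟩
    · obtain ⟨q1, q2, q3, q4⟩ := hab' ⟨j.val - 1, by omega⟩
      exact ⟨q1, Nat.zero_le _, q3, q4⟩
  have n2 : ∀ i : Fin T, ¬ (a' i < a i.succ ∧ b' i < b i.succ) := by
    rintro i ⟨h1, h2⟩
    refine hc2 ⟨_, _, splice2 ha ha' i h1, splice2 hb hb' i h2, fun j => ?_⟩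
    split_ifs with hj
    · obtain ⟨q1, q2, q3, q4⟩ := hab' ⟨j.val, by omega⟩
      exact ⟨q1, q2, by omega, q4⟩
    · have e := hb.monotone (Fin.le_def.2 (by simp only [Fin.val_succ]; omega) : i.succ ≤ j)
      have e2 := (hab' i).2.1
      have e : (b i.succ).val ≤ (b j).val := e
      have h2 : (b' i).val < (b i.succ).val := h2
      exact ⟨(hab j).1, by omega, (hab j).2.2.1, (hab j).2.2.2⟩
  have h0 : (b 0).val = 0 := by
    by_contra h0
    refine hc2 ⟨a, b, ha, hb, fun j => ⟨(hab j).1, ?_, (hab j).2.2⟩⟩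
    have e : (b 0).val ≤ (b j).val := hb.monotone (Fin.zero_le j)
    omega
  have hl : T + 2 ≤ (b (Fin.last T)).val := by
    by_contra hl
    refine hc1 ⟨a, b, ha, hb, fun j => ⟨(hab j).1, Nat.zero_le _, ?_, (hab j).2.2.2⟩⟩
    have e : (b j).val ≤ (b (Fin.last T)).val := hb.monotone (Fin.le_last j)
    omega
  have main : ∀ i (hi : i < T), b (Fin.castSucc ⟨i, hi⟩) < b' ⟨i, hi⟩ := by
    intro i
    induction i with
    | zero =>
      intro hi
      have e := (hab' ⟨0, hi⟩).2.1
      refine Fin.lt_def.2 ?_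
      have : Fin.castSucc (⟨0, hi⟩ : Fin T) = 0 := rfl
      rw [this, h0]
      omega
    | succ i ih =>
      intro hi
      have hi' : i < T := by omega
      have h1 := ih hi'
      have h2 : a' ⟨i, hi'⟩ ≤ a (Fin.castSucc ⟨i, hi'⟩) := by
        by_contra h
        exact n1 ⟨i, hi'⟩ ⟨not_le.1 h, h1⟩
      have h3 : a' ⟨i, hi'⟩ < a (Fin.succ ⟨i, hi'⟩) := lt_of_le_of_lt h2 (ha Fin.castSucc_lt_succ)
      have h4 : b (Fin.succ ⟨i, hi'⟩) ≤ b' ⟨i, hi'⟩ := by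
        by_contra h
        exact n2 ⟨i, hi'⟩ ⟨h3, not_le.1 h⟩
      exact lt_of_le_of_lt h4 (hb' (Fin.lt_def.2 (Nat.lt_succ_self i)))
  have hi' : T - 1 < T := by omega
  have h1 := main (T - 1) hi'
  have h2 : a' ⟨T - 1, hi'⟩ ≤ a (Fin.castSucc ⟨T - 1, hi'⟩) := by
    by_contra h
    exact n1 ⟨T - 1, hi'⟩ ⟨not_le.1 h, h1⟩
  have h3 : a' ⟨T - 1, hi'⟩ < a (Fin.succ ⟨T - 1, hi'⟩) :=
    lt_of_le_of_lt h2 (ha Fin.castSucc_lt_succ)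
  have h4 : b (Fin.succ ⟨T - 1, hi'⟩) ≤ b' ⟨T - 1, hi'⟩ := by
    by_contra h
    exact n2 ⟨T - 1, hi'⟩ ⟨h3, not_le.1 h⟩
  have h5 : Fin.succ (⟨T - 1, hi'⟩ : Fin T) = Fin.last T := by
    ext
    simp only [Fin.val_succ, Fin.val_last]
    omega
  rw [h5] at h4
  have h4 : (b (Fin.last T)).val ≤ (b' ⟨T - 1, hi'⟩).val := h4
  have := (hab' ⟨T - 1, hi'⟩).2.2.1
  omega

end splice

section laplace
variable {K : Type*} [Field K] {m n : ℕ}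

theorem laplace_first {T hi : ℕ} : Ideal.span (gens K m n (T + 1) 0 hi) ≤
    Ideal.span (gens K m n T 1 hi) := by
  rw [Ideal.span_le]
  rintro _ ⟨r, c, hr, hc, _, h2, rfl⟩
  rw [Matrix.det_succ_column_zero]
  refine Ideal.sum_mem _ fun i _ => Ideal.mul_mem_left _ _ (Ideal.subset_span ?_)
  refine ⟨r ∘ i.succAbove, c ∘ Fin.succ, hr.comp (Fin.strictMono_succAbove i),
    hc.comp Fin.strictMono_succ, fun j => ⟨by omega, (r _).2⟩, fun j => ⟨?_, (h2 _).2⟩, rfl⟩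
  have : (c 0).val < (c j.succ).val := hc (Fin.succ_pos j)
  simp only [Function.comp]
  omega

theorem laplace_last {T lo hi : ℕ} : Ideal.span (gens K m n (T + 1) lo (hi + 1)) ≤
    Ideal.span (gens K m n T lo hi) := by
  rw [Ideal.span_le]
  rintro _ ⟨r, c, hr, hc, _, h2, rfl⟩
  rw [Matrix.det_succ_column _ (Fin.last T)]
  refine Ideal.sum_mem _ fun i _ => Ideal.mul_mem_left _ _ (Ideal.subset_span ?_)
  refine ⟨r ∘ i.succAbove, c ∘ (Fin.last T).succAbove, hr.comp (Fin.strictMono_succAbove i),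
    hc.comp (Fin.strictMono_succAbove _), fun j => ⟨by omega, (r _).2⟩,
    fun j => ⟨(h2 _).1, ?_⟩, rfl⟩
  simp only [Function.comp, Fin.succAbove_last]
  have : (c j.castSucc).val < (c (Fin.last T)).val := hc (Fin.castSucc_lt_last j)
  have := (h2 (Fin.last T)).2
  omega

theorem gens_mono {t lo hi lo' hi' : ℕ} (h1 : lo' ≤ lo) (h2 : hi ≤ hi') :
    gens K m n t lo hi ⊆ gens K m n t lo' hi' := by
  rintro _ ⟨r, c, hr, hc, hrr, hcc, rfl⟩
  exact ⟨r, c, hr, hc, hrr, fun j => ⟨by have := (hcc j).1; omega, by have := (hcc j).2; omega⟩, rfl⟩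

theorem main_aux {T : ℕ} (hT : 1 ≤ T) (hn : T + 3 ≤ n) :
    Ideal.span (gens K m n (T + 1) 0 (T + 2)) ⊔ Ideal.span (gens K m n (T + 1) 1 (T + 3)) =
      Ideal.span (gens K m n (T + 1) 0 (T + 3)) ⊓ Ideal.span (gens K m n T 1 (T + 2)) := by
  have hle : Ideal.span (gens K m n (T + 1) 0 (T + 2)) ⊔ Ideal.span (gens K m n (T + 1) 1 (T + 3)) ≤
      Ideal.span (gens K m n (T + 1) 0 (T + 3)) ⊓ Ideal.span (gens K m n T 1 (T + 2)) := by
    refine sup_le (le_inf ?_ laplace_first) (le_inf ?_ laplace_last)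
    · exact Ideal.span_mono (gens_mono le_rfl (by omega))
    · exact Ideal.span_mono (gens_mono (by omega) le_rfl)
  refine le_antisymm hle fun f hf => ?_
  rw [← Ideal.span_union] at hle ⊢
  set B := gens K m n (T + 1) 0 (T + 2) ∪ gens K m n (T + 1) 1 (T + 3) with hB
  obtain ⟨g, q, hfq, -, hq⟩ := (diagOrd m n).div_set (B := B)
    (by rintro b (hb | hb) <;> exact gens_lead hb) f
  have hS : Finsupp.linearCombination _
      (fun (b : B) ↦ (b : MvPolynomial (Fin m × Fin n) K)) g ∈ Ideal.span B := by
    rw [Finsupp.linearCombination_apply]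
    exact Submodule.sum_mem _ fun b _ => Submodule.smul_mem _ _ (Ideal.subset_span b.2)
  have hqI : q ∈ Ideal.span (gens K m n (T + 1) 0 (T + 3)) ⊓
      Ideal.span (gens K m n T 1 (T + 2)) := by
    have : q = f - Finsupp.linearCombination _
      (fun (b : B) ↦ (b : MvPolynomial (Fin m × Fin n) K)) g := by
      rw [hfq]; ring
    rw [this]
    exact sub_mem hf (hle hS)
  have hq0 : q = 0 := by
    by_contra hq0
    have c1 := groebner (by omega) hn hqI.1 hq0
    have c2 := groebner hT (by omega) hqI.2 hq0
    have hsupp := (diagOrd m n).degree_mem_support hq0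
    rcases chain_splice hT c1 c2 with h | h
    · obtain ⟨b, hb, hbu⟩ := chain_gens K h
      exact hq _ hsupp b (Or.inl hb) hbu
    · obtain ⟨b, hb, hbu⟩ := chain_gens K h
      exact hq _ hsupp b (Or.inr hb) hbu
  rw [hfq, hq0, add_zero]
  exact hS

end laplace

end AdjMinors

/-- `I_t(X_{[1,t+1]}) + I_t(X_{[2,t+2]}) = I_t(X_{[1,t+2]}) ∩ I_{t-1}(X_{[2,t+1]})`. -/
theorem sum_adjacent_minors_width_succ (K : Type*) [Field K] (m n : ℕ)
    (hm : 0 < m) (hmn : m ≤ n) (t : ℕ) (ht2 : 2 ≤ t) (htm : t ≤ m) (htn : t + 2 ≤ n) :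
    genMinors K m n t 1 m 1 (t + 1) + genMinors K m n t 1 m 2 (t + 2)
      = genMinors K m n t 1 m 1 (t + 2) ⊓ genMinors K m n (t - 1) 1 m 2 (t + 1) := by
  obtain ⟨T, rfl⟩ : ∃ T, t = T + 1 := ⟨t - 1, by omega⟩
  exact AdjMinors.main_aux (K := K) (m := m) (n := n) (T := T) (by omega) (by omega)
end

section
/- Let K be a field, m ≤ n positive integers, X the m×n generic matrix over S = K[x_{ij}], and t an integer with 2 ≤ t ≤ m and t ≤ n − 2. Then I_t(X_{[1,n−1]}) + I_t(X_{[2,n]}) = I_t(X_{[1,n]}) ∩ I_{t−1}(X_{[2,n−1]}) as ideals of S. -/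
open MvPolynomial

/-- weight of a cell -/
def cellWt {m n : ℕ} (x : Fin m × Fin n) : ℕ := (x.1.val + 1) * (x.2.val + 1)

lemma cellWt_eq_card {m n : ℕ} (x : Fin m × Fin n) : cellWt x = (Finset.Iic x).card := by
  rw [Finset.card_Iic_prod]; simp [cellWt]

lemma sum_cellWt {m n : ℕ} (a : Fin m × Fin n → ℕ) :
    ∑ x, a x * cellWt x = ∑ p, ∑ x ∈ Finset.Ici p, a x := by
  classical
  have h : ∀ x, a x * cellWt x = ∑ p, if p ≤ x then a x else 0 := by
    intro x
    rw [cellWt_eq_card, ← Finset.sum_filter, Finset.sum_const, smul_eq_mul, mul_comm]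
    congr 2
    ext p; simp
  simp_rw [h]
  rw [Finset.sum_comm]
  refine Finset.sum_congr rfl fun p _ => ?_
  rw [← Finset.sum_filter]
  refine Finset.sum_congr ?_ fun _ _ => rfl
  ext x; simp

lemma antichain_corner {m n : ℕ} (a b : Fin m × Fin n → ℕ)
    (hr : ∀ i, ∑ j, a (i, j) = ∑ j, b (i, j)) (hc : ∀ j, ∑ i, a (i, j) = ∑ i, b (i, j))
    (ha : ∀ x y, a x ≠ 0 → a y ≠ 0 → x.1 < y.1 → ¬ x.2 < y.2) (p : Fin m × Fin n) :
    ∑ x ∈ Finset.Ici p, a x ≤ ∑ x ∈ Finset.Ici p, b x := by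
  classical
  have key : ∀ u : Fin m × Fin n → ℕ,
      (∑ i, if p.1 ≤ i then ∑ j, u (i, j) else 0) + (∑ j, if p.2 ≤ j then ∑ i, u (i, j) else 0)
        + (∑ x, if x.1 < p.1 ∧ x.2 < p.2 then u x else 0)
      = (∑ i, ∑ j, u (i, j)) + ∑ x ∈ Finset.Ici p, u x := by
    intro u
    have e1 : (∑ i, if p.1 ≤ i then ∑ j, u (i, j) else 0) = ∑ x, if p.1 ≤ x.1 then u x else 0 := by
      rw [Fintype.sum_prod_type]
      refine Finset.sum_congr rfl fun i _ => ?_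
      split_ifs <;> simp
    have e2 : (∑ j, if p.2 ≤ j then ∑ i, u (i, j) else 0) = ∑ x, if p.2 ≤ x.2 then u x else 0 := by
      rw [Fintype.sum_prod_type_right]
      refine Finset.sum_congr rfl fun i _ => ?_
      split_ifs <;> simp
    have e3 : ∑ x ∈ Finset.Ici p, u x = ∑ x, if p ≤ x then u x else 0 := by
      rw [← Finset.sum_filter]
      refine Finset.sum_congr ?_ fun _ _ => rfl
      ext x; simp
    rw [e1, e2, e3, ← Fintype.sum_prod_type, ← Finset.sum_add_distrib, ← Finset.sum_add_distrib,
      ← Finset.sum_add_distrib]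
    refine Finset.sum_congr rfl fun x _ => ?_
    have hle : p ≤ x ↔ p.1 ≤ x.1 ∧ p.2 ≤ x.2 := Iff.rfl
    simp only [hle, ← not_le]
    by_cases h1 : p.1 ≤ x.1 <;> by_cases h2 : p.2 ≤ x.2 <;> simp [h1, h2]
  by_cases hz : ∀ x ∈ Finset.Ici p, a x = 0
  · rw [Finset.sum_eq_zero hz]; exact Nat.zero_le _
  · push Not at hz
    obtain ⟨y, hy, hay⟩ := hz
    have hyp : p ≤ y := by simpa using hy
    have hN : (∑ x, if x.1 < p.1 ∧ x.2 < p.2 then a x else 0) = 0 := by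
      refine Finset.sum_eq_zero fun x _ => ?_
      split_ifs with h
      · by_contra hx
        exact ha x y hx hay (lt_of_lt_of_le h.1 hyp.1) (lt_of_lt_of_le h.2 hyp.2)
      · rfl
    have ka := key a
    have kb := key b
    simp_rw [hr, hc] at ka
    omega

lemma antichain_min {m n : ℕ} (a b : Fin m × Fin n → ℕ)
    (hr : ∀ i, ∑ j, a (i, j) = ∑ j, b (i, j)) (hc : ∀ j, ∑ i, a (i, j) = ∑ i, b (i, j))
    (ha : ∀ x y, a x ≠ 0 → a y ≠ 0 → x.1 < y.1 → ¬ x.2 < y.2) :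
    ∑ x, a x * cellWt x ≤ ∑ x, b x * cellWt x := by
  rw [sum_cellWt, sum_cellWt]
  exact Finset.sum_le_sum fun p _ => antichain_corner a b hr hc ha p

lemma antichain_unique {m n : ℕ} (a b : Fin m × Fin n → ℕ)
    (hr : ∀ i, ∑ j, a (i, j) = ∑ j, b (i, j)) (hc : ∀ j, ∑ i, a (i, j) = ∑ i, b (i, j))
    (ha : ∀ x y, a x ≠ 0 → a y ≠ 0 → x.1 < y.1 → ¬ x.2 < y.2)
    (h : ∑ x, a x * cellWt x = ∑ x, b x * cellWt x) : a = b := by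
  classical
  rw [sum_cellWt, sum_cellWt,
    Finset.sum_eq_sum_iff_of_le fun p _ => antichain_corner a b hr hc ha p] at h
  funext p
  induction p using WellFoundedGT.induction with
  | ind p ih =>
    have hp := h p (Finset.mem_univ _)
    have hmem : p ∈ Finset.Ici p := by simp
    rw [← Finset.add_sum_erase _ a hmem, ← Finset.add_sum_erase _ b hmem] at hp
    have hx : ∑ x ∈ (Finset.Ici p).erase p, a x = ∑ x ∈ (Finset.Ici p).erase p, b x := by
      refine Finset.sum_congr rfl fun x hx => ih x ?_
      rw [Finset.mem_erase, Finset.mem_Ici] at hx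
      exact lt_of_le_of_ne hx.2 (Ne.symm hx.1)
    omega

lemma strictMono_cons {α : Type*} [Preorder α] {s : ℕ} (x : α) (f : Fin (s + 1) → α)
    (h : x < f 0) (hf : StrictMono f) : StrictMono (Fin.cons x f : Fin (s + 2) → α) := by
  intro i j hij
  induction j using Fin.cases with
  | zero => exact absurd hij (Fin.not_lt_zero i)
  | succ j =>
    induction i using Fin.cases with
    | zero => simpa using lt_of_lt_of_le h (hf.monotone (Fin.zero_le j))
    | succ i => simpa using hf (Fin.succ_lt_succ_iff.1 hij)

lemma exists_coloring {m n : ℕ} (s : ℕ) : ∀ (S : Finset (Fin m × Fin n)),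
    (¬ ∃ (r : Fin (s + 1) → Fin m) (c : Fin (s + 1) → Fin n), StrictMono r ∧ StrictMono c ∧
      ∀ i, (r i, c i) ∈ S) →
    ∃ κ : Fin m × Fin n → ℕ, (∀ x ∈ S, κ x < s) ∧
      ∀ x ∈ S, ∀ y ∈ S, x.1 < y.1 → x.2 < y.2 → κ x ≠ κ y := by
  classical
  induction s with
  | zero =>
    intro S hS
    have : ∀ x, x ∉ S := fun x hx => hS ⟨fun _ => x.1, fun _ => x.2,
      fun i j hij => by rw [Fin.lt_def] at hij; omega,
      fun i j hij => by rw [Fin.lt_def] at hij; omega, fun _ => hx⟩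
    exact ⟨fun _ => 0, fun x hx => (this x hx).elim, fun x hx => (this x hx).elim⟩
  | succ s ih =>
    intro S hS
    obtain ⟨κ, h1, h2⟩ := ih (S.filter fun x => ∃ y ∈ S, y.1 < x.1 ∧ y.2 < x.2) (by
      rintro ⟨r, c, hr, hc, hm⟩
      obtain ⟨y, hy, hy1, hy2⟩ := (Finset.mem_filter.1 (hm 0)).2
      refine hS ⟨Fin.cons y.1 r, Fin.cons y.2 c, ?_, ?_, ?_⟩
      · exact strictMono_cons _ _ hy1 hr
      · exact strictMono_cons _ _ hy2 hc
      · intro i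
        refine Fin.cases ?_ (fun i => ?_) i
        · simpa using hy
        · simpa using (Finset.mem_filter.1 (hm i)).1)
    refine ⟨fun x => if x ∈ (S.filter fun x => ∃ y ∈ S, y.1 < x.1 ∧ y.2 < x.2) then κ x + 1 else 0,
      ?_, ?_⟩
    · intro x hx
      dsimp only
      split_ifs with h
      · have := h1 x h; omega
      · omega
    · intro x hx y hy hxy1 hxy2
      have hy' : y ∈ (S.filter fun x => ∃ y ∈ S, y.1 < x.1 ∧ y.2 < x.2) :=
        Finset.mem_filter.2 ⟨hy, x, hx, hxy1, hxy2⟩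
      simp only [hy', if_true]
      split_ifs with h
      · have := h2 x h y hy' hxy1 hxy2
        omega
      · omega

lemma crossing {m n : ℕ} (s : ℕ) (hs : 0 < s) (S : Set (Fin m × Fin n))
    (dr : Fin (s + 1) → Fin m) (dc : Fin (s + 1) → Fin n) (er : Fin s → Fin m) (ec : Fin s → Fin n)
    (hdr : StrictMono dr) (hdc : StrictMono dc) (her : StrictMono er) (hec : StrictMono ec)
    (hD : ∀ i, (dr i, dc i) ∈ S) (hE : ∀ i, (er i, ec i) ∈ S)
    (hec1 : ∀ i, 1 ≤ (ec i).val) (hec2 : ∀ i, (ec i).val + 1 < n) :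
    ∃ (r : Fin (s + 1) → Fin m) (c : Fin (s + 1) → Fin n), StrictMono r ∧ StrictMono c ∧
      (∀ i, (r i, c i) ∈ S) ∧ ((∀ i, 1 ≤ (c i).val) ∨ (∀ i, (c i).val + 1 < n)) := by
  by_cases h0 : 1 ≤ (dc 0).val
  · exact ⟨dr, dc, hdr, hdc, hD, Or.inl fun i => h0.trans (hdc.monotone (Fin.zero_le i))⟩
  by_cases hl : (dc (Fin.last s)).val + 1 < n
  · refine ⟨dr, dc, hdr, hdc, hD, Or.inr fun i => ?_⟩
    have : dc i ≤ dc (Fin.last s) := hdc.monotone (Fin.le_last i)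
    have : (dc i).val ≤ (dc (Fin.last s)).val := this
    omega
  have hex : ∃ k : Fin s, (dr k.castSucc < er k ∧ dc k.castSucc < ec k) ∨
      (er k < dr k.succ ∧ ec k < dc k.succ) := by
    by_contra hcon
    push Not at hcon
    have hind : ∀ k : ℕ, ∀ hk : k < s, er ⟨k, hk⟩ ≤ dr (Fin.castSucc ⟨k, hk⟩) ∧
        dc (Fin.castSucc ⟨k, hk⟩) < ec ⟨k, hk⟩ := by
      intro k
      induction k with
      | zero =>
        intro hk
        have hcol : dc (Fin.castSucc ⟨0, hk⟩) < ec ⟨0, hk⟩ := by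
          have := hec1 ⟨0, hk⟩
          have e : (Fin.castSucc ⟨0, hk⟩ : Fin (s + 1)) = 0 := rfl
          rw [e, Fin.lt_def]; omega
        refine ⟨?_, hcol⟩
        by_contra hlt
        exact absurd hcol (not_lt.2 ((hcon ⟨0, hk⟩).1 (not_le.1 hlt)))
      | succ k ih =>
        intro hk
        obtain ⟨i1, i2⟩ := ih (by omega)
        have e : (Fin.castSucc ⟨k + 1, hk⟩ : Fin (s + 1)) = Fin.succ ⟨k, by omega⟩ := rfl
        have l1 : dr (Fin.castSucc ⟨k, by omega⟩) < dr (Fin.succ ⟨k, by omega⟩) :=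
          hdr (Fin.castSucc_lt_succ)
        have l2 := (hcon ⟨k, by omega⟩).2 (lt_of_le_of_lt i1 l1)
        have l3 : ec ⟨k, by omega⟩ < ec ⟨k + 1, hk⟩ := hec (by simp [Fin.lt_def])
        have hcol : dc (Fin.castSucc ⟨k + 1, hk⟩) < ec ⟨k + 1, hk⟩ := by
          rw [e]; exact lt_of_le_of_lt l2 l3
        refine ⟨?_, hcol⟩
        by_contra hlt
        exact absurd hcol (not_lt.2 ((hcon ⟨k + 1, hk⟩).1 (not_le.1 hlt)))
    obtain ⟨i1, i2⟩ := hind (s - 1) (by omega)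
    have l1 : dr (Fin.castSucc ⟨s - 1, by omega⟩) < dr (Fin.succ ⟨s - 1, by omega⟩) :=
      hdr (Fin.castSucc_lt_succ)
    have l2 := (hcon ⟨s - 1, by omega⟩).2 (lt_of_le_of_lt i1 l1)
    have e : (Fin.succ ⟨s - 1, by omega⟩ : Fin (s + 1)) = Fin.last s := by
      ext; simp; omega
    rw [e, Fin.le_def] at l2
    have := hec2 ⟨s - 1, by omega⟩
    omega
  obtain ⟨k, hk | hk⟩ := hex
  · -- prefix of D, suffix of E
    refine ⟨fun i => if h : i.val ≤ k.val then dr i else er ⟨i.val - 1, by omega⟩,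
      fun i => if h : i.val ≤ k.val then dc i else ec ⟨i.val - 1, by omega⟩, ?_, ?_, ?_, Or.inr ?_⟩
    · intro i j hij
      have hij' : i.val < j.val := hij
      dsimp only
      split_ifs with h1 h2 h2
      · exact hdr hij
      · exact lt_of_le_of_lt (hdr.monotone (show i ≤ k.castSucc from h1))
          (lt_of_lt_of_le hk.1 (her.monotone (by rw [Fin.le_def]; simp; omega)))
      · omega
      · exact her (by rw [Fin.lt_def]; simp; omega)
    · intro i j hij
      have hij' : i.val < j.val := hij
      dsimp only
      split_ifs with h1 h2 h2
      · exact hdc hij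
      · exact lt_of_le_of_lt (hdc.monotone (show i ≤ k.castSucc from h1))
          (lt_of_lt_of_le hk.2 (hec.monotone (by rw [Fin.le_def]; simp; omega)))
      · omega
      · exact hec (by rw [Fin.lt_def]; simp; omega)
    · intro i
      dsimp only
      split_ifs
      · exact hD _
      · exact hE _
    · intro i
      dsimp only
      split_ifs with h1
      · have h3 : dc i ≤ dc k.castSucc := hdc.monotone (show i ≤ k.castSucc from h1)
        have h4 := lt_of_le_of_lt h3 hk.2
        have := hec2 k
        rw [Fin.lt_def] at h4
        omega
      · exact hec2 _
  · refine ⟨fun i => if h : i.val ≤ k.val then er ⟨i.val, by omega⟩ else dr i,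
      fun i => if h : i.val ≤ k.val then ec ⟨i.val, by omega⟩ else dc i, ?_, ?_, ?_, Or.inl ?_⟩
    · intro i j hij
      have hij' : i.val < j.val := hij
      dsimp only
      split_ifs with h1 h2 h2
      · exact her (by rw [Fin.lt_def]; simpa using hij')
      · exact lt_of_le_of_lt (her.monotone (show _ ≤ k from h1))
          (lt_of_lt_of_le hk.1 (hdr.monotone (by rw [Fin.le_def]; simp; omega)))
      · omega
      · exact hdr hij
    · intro i j hij
      have hij' : i.val < j.val := hij
      dsimp only
      split_ifs with h1 h2 h2
      · exact hec (by rw [Fin.lt_def]; simpa using hij')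
      · exact lt_of_le_of_lt (hec.monotone (show _ ≤ k from h1))
          (lt_of_lt_of_le hk.2 (hdc.monotone (by rw [Fin.le_def]; simp; omega)))
      · omega
      · exact hdc hij
    · intro i
      dsimp only
      split_ifs
      · exact hE _
      · exact hD _
    · intro i
      dsimp only
      split_ifs with h1
      · exact hec1 _
      · have h4 : dc k.succ ≤ dc i := hdc.monotone (by rw [Fin.le_def]; simp; omega)
        have h5 := lt_of_lt_of_le hk.2 h4
        have := hec1 k
        rw [Fin.lt_def] at h5
        omega

lemma weight_fintype {α : Type*} [Fintype α] (w : α → ℕ) (a : α →₀ ℕ) :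
    Finsupp.weight w a = ∑ x, a x * w x := by
  rw [Finsupp.weight_apply, Finsupp.sum_fintype _ _ (by simp)]
  simp

lemma perm_eq_one_of_monovary {t m n : ℕ} (r : Fin t → Fin m) (c : Fin t → Fin n)
    (hr : StrictMono r) (hc : StrictMono c) (σ : Equiv.Perm (Fin t))
    (h : Monovary ((fun i => (r i).val + 1) ∘ σ) (fun i => (c i).val + 1)) : σ = 1 := by
  have hm : StrictMono σ := by
    intro i j hij
    have h1 : (c i).val + 1 < (c j).val + 1 := by
      have := hc hij
      rw [Fin.lt_def] at this; omega
    have h2 : (r (σ i)).val + 1 ≤ (r (σ j)).val + 1 := h h1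
    have h3 : r (σ i) ≤ r (σ j) := by rw [Fin.le_def]; omega
    exact lt_of_le_of_ne (hr.le_iff_le.1 h3) (fun e => hij.ne (σ.injective e))
  have := (StrictMono.range_inj hm strictMono_id).1 (by simp [σ.surjective.range_eq])
  ext i; simp [this]

lemma minor_reduce {K : Type*} [CommRing K] {m n t : ℕ} (r : Fin t → Fin m) (c : Fin t → Fin n)
    (hr : StrictMono r) (hc : StrictMono c) (a : Fin m × Fin n →₀ ℕ)
    (ha : ∀ i, a (r i, c i) ≠ 0) (q : K) :
    ∃ h : MvPolynomial (Fin m × Fin n) K,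
      monomial a q - h * Matrix.det (Matrix.of fun i j => X (r i, c j)) ∈
        restrictSupport K {b | Finsupp.weight cellWt b < Finsupp.weight cellWt a} := by
  classical
  set D : Equiv.Perm (Fin t) → (Fin m × Fin n →₀ ℕ) :=
    fun σ => ∑ i, Finsupp.single (r (σ i), c i) 1 with hDdef
  have hwD : ∀ σ, Finsupp.weight cellWt (D σ) = ∑ i, ((r (σ i)).val + 1) * ((c i).val + 1) := by
    intro σ
    simp [hDdef, map_sum, Finsupp.weight_single, cellWt]
  have hmono : Monovary (fun i => (r i).val + 1) (fun i => (c i).val + 1) := by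
    intro i j hij
    have h1 : i < j := hc.lt_iff_lt.1 (by rw [Fin.lt_def]; simp at hij; omega)
    have h2 := hr h1
    rw [Fin.lt_def] at h2
    dsimp only; omega
  have hlt : ∀ σ, σ ≠ 1 → Finsupp.weight cellWt (D σ) < Finsupp.weight cellWt (D 1) := by
    intro σ hσ
    rw [hwD, hwD]
    exact (hmono.sum_comp_perm_mul_lt_sum_mul_iff (σ := σ)).2
      fun h => hσ (perm_eq_one_of_monovary r c hr hc σ h)
  have hDa : D 1 ≤ a := by
    intro x
    by_cases hx : ∃ i, (r i, c i) = x
    · obtain ⟨i, rfl⟩ := hx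
      have : (D 1) (r i, c i) = 1 := by
        simp only [hDdef, Finsupp.finsetSum_apply, Equiv.Perm.coe_one, id]
        rw [Finset.sum_eq_single i]
        · simp
        · intro j _ hj
          rw [Finsupp.single_apply, if_neg]
          intro e
          exact hj (hr.injective (Prod.ext_iff.1 e).1)
        · simp
      rw [this]
      exact Nat.one_le_iff_ne_zero.2 (ha i)
    · have : (D 1) x = 0 := by
        simp only [hDdef, Finsupp.finsetSum_apply, Equiv.Perm.coe_one, id]
        refine Finset.sum_eq_zero fun j _ => ?_
        rw [Finsupp.single_apply, if_neg]
        exact fun e => hx ⟨j, e⟩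
      rw [this]; exact Nat.zero_le _
  have hdet : Matrix.det (Matrix.of fun i j => (X (r i, c j) : MvPolynomial (Fin m × Fin n) K))
      = ∑ σ : Equiv.Perm (Fin t), Equiv.Perm.sign σ • monomial (D σ) (1 : K) := by
    rw [Matrix.det_apply]
    refine Finset.sum_congr rfl fun σ _ => ?_
    congr 1
    rw [hDdef, monomial_sum_one]
    rfl
  refine ⟨monomial (a - D 1) q, ?_⟩
  have hsub : monomial a q - monomial (a - D 1) q *
      Matrix.det (Matrix.of fun i j => (X (r i, c j) : MvPolynomial (Fin m × Fin n) K))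
      = - ∑ σ ∈ (Finset.univ : Finset (Equiv.Perm (Fin t))).erase 1,
          Equiv.Perm.sign σ • monomial (a - D 1 + D σ) q := by
    rw [hdet, ← Finset.add_sum_erase _ _ (Finset.mem_univ (1 : Equiv.Perm (Fin t))), mul_add,
      Finset.mul_sum]
    simp [monomial_mul, mul_smul_comm, tsub_add_cancel_of_le hDa]
  rw [hsub]
  refine Submodule.neg_mem _ (Submodule.sum_mem _ fun σ hσ => ?_)
  have hmem : monomial (a - D 1 + D σ) q ∈
      restrictSupport K {b | Finsupp.weight cellWt b < Finsupp.weight cellWt a} := by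
    rw [monomial_mem_restrictSupport]
    left
    have := hlt σ (Finset.ne_of_mem_erase hσ)
    have e : Finsupp.weight cellWt a = Finsupp.weight cellWt (a - D 1) +
        Finsupp.weight cellWt (D 1) := by
      rw [← map_add, tsub_add_cancel_of_le hDa]
    simp only [Set.mem_ofPred_eq, map_add]
    omega
  rcases Int.units_eq_one_or (Equiv.Perm.sign σ) with h | h <;> rw [h]
  · simpa using hmem
  · simpa [Units.smul_def] using hmem

section Param

variable (K : Type*) [CommRing K] (m n s : ℕ) (C : Fin n → Prop)

/-- The variables of the parametrization. -/
abbrev PVar := (Fin m × Fin s) ⊕ (Fin s × Fin n) ⊕ ((Fin m × Fin n) × Fin s)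

open Classical in
/-- exponent of the image of a coloured variable -/
noncomputable def pexp (x : (Fin m × Fin n) × Fin s) : PVar m n s →₀ ℕ :=
  if C x.1.2 then
    Finsupp.single (Sum.inl (x.1.1, x.2)) 1 + Finsupp.single (Sum.inr (Sum.inl (x.2, x.1.2))) 1
  else Finsupp.single (Sum.inr (Sum.inr x)) 1

/-- the map splitting each variable into a sum of coloured copies -/
noncomputable def splitHom : MvPolynomial (Fin m × Fin n) K →ₐ[K]
    MvPolynomial ((Fin m × Fin n) × Fin s) K :=
  aeval fun c => ∑ k, X (c, k)

/-- the toric map on each coloured copy -/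
noncomputable def toricHom : MvPolynomial ((Fin m × Fin n) × Fin s) K →ₐ[K]
    MvPolynomial (PVar m n s) K :=
  aeval fun x => monomial (pexp m n s C x) 1

/-- the toric map on exponents -/
noncomputable def pexpSum (β : (Fin m × Fin n) × Fin s →₀ ℕ) : PVar m n s →₀ ℕ :=
  ∑ x, β x • pexp m n s C x

lemma toricHom_monomial (β : (Fin m × Fin n) × Fin s →₀ ℕ) (q : K) :
    toricHom K m n s C (monomial β q) = monomial (pexpSum m n s C β) q := by
  rw [toricHom, aeval_monomial, Finsupp.prod_fintype _ _ (by simp), pexpSum]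
  simp only [monomial_pow, one_pow]
  rw [← monomial_sum_one, algebraMap_eq, C_mul_monomial, mul_one]

lemma toric_kills_minor (r : Fin (s + 1) → Fin m) (c : Fin (s + 1) → Fin n)
    (hc : ∀ j, C (c j)) :
    toricHom K m n s C (splitHom K m n s (Matrix.det (Matrix.of fun i j => X (r i, c j)))) = 0 := by
  classical
  rw [AlgHom.map_det, AlgHom.map_det]
  set A : Matrix (Fin (s + 1)) (Fin (s + 1)) (MvPolynomial (PVar m n s) K) :=
    Matrix.of fun i k => Fin.cases 0 (fun k => X (Sum.inl (r i, k))) k with hA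
  set B : Matrix (Fin (s + 1)) (Fin (s + 1)) (MvPolynomial (PVar m n s) K) :=
    Matrix.of fun k j => Fin.cases 0 (fun k => X (Sum.inr (Sum.inl (k, c j)))) k with hB
  have : (toricHom K m n s C).mapMatrix ((splitHom K m n s).mapMatrix
      (Matrix.of fun i j => X (r i, c j))) = A * B := by
    ext1 i j
    rw [Matrix.mul_apply, Fin.sum_univ_succ]
    simp [hA, hB, splitHom, toricHom, pexp, hc]
    simp [X, monomial_mul]
  rw [this, Matrix.det_mul, Matrix.det_eq_zero_of_column_eq_zero (A := A) 0, zero_mul]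
  intro i
  simp [hA]

lemma pexpSum_row (β : (Fin m × Fin n) × Fin s →₀ ℕ) (i : Fin m) (k : Fin s) [DecidablePred C] :
    pexpSum m n s C β (Sum.inl (i, k)) = ∑ j, if C j then β ((i, j), k) else 0 := by
  classical
  have h : ∀ x : (Fin m × Fin n) × Fin s, (β x • pexp m n s C x) (Sum.inl (i, k)) =
      if x.2 = k then (if x.1.1 = i then (if C x.1.2 then β x else 0) else 0) else 0 := by
    rintro ⟨⟨i', j⟩, k'⟩
    by_cases hC : C j <;> by_cases h1 : i' = i <;> by_cases h2 : k' = k <;>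
      simp [pexp, hC, h1, h2]
  rw [pexpSum, Finsupp.finsetSum_apply]
  simp_rw [h]
  rw [Fintype.sum_prod_type_right, Finset.sum_eq_single k (by intro b _ hb; simp [hb]) (by simp),
    Fintype.sum_prod_type, Finset.sum_eq_single i (by intro b _ hb; simp [hb]) (by simp)]
  simp

lemma pexpSum_col (β : (Fin m × Fin n) × Fin s →₀ ℕ) (j : Fin n) (k : Fin s) [DecidablePred C] :
    pexpSum m n s C β (Sum.inr (Sum.inl (k, j))) = ∑ i, if C j then β ((i, j), k) else 0 := by
  classical
  have h : ∀ x : (Fin m × Fin n) × Fin s, (β x • pexp m n s C x) (Sum.inr (Sum.inl (k, j))) =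
      if x.2 = k then (if x.1.2 = j then (if C x.1.2 then β x else 0) else 0) else 0 := by
    rintro ⟨⟨i', j'⟩, k'⟩
    by_cases h1 : j' = j
    · subst h1
      by_cases hC : C j' <;> by_cases h2 : k' = k <;> simp [pexp, hC, h2]
    · by_cases hC : C j' <;> by_cases h2 : k' = k <;> simp [pexp, hC, h1, h2]
  rw [pexpSum, Finsupp.finsetSum_apply]
  simp_rw [h]
  rw [Fintype.sum_prod_type_right, Finset.sum_eq_single k (by intro b _ hb; simp [hb]) (by simp),
    Fintype.sum_prod_type_right, Finset.sum_eq_single j (by intro b _ hb; simp [hb]) (by simp)]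
  exact Finset.sum_congr rfl fun i _ => by simp

lemma pexpSum_out (β : (Fin m × Fin n) × Fin s →₀ ℕ) (y : (Fin m × Fin n) × Fin s)
    (hy : ¬ C y.1.2) :
    pexpSum m n s C β (Sum.inr (Sum.inr y)) = β y := by
  classical
  have h : ∀ x : (Fin m × Fin n) × Fin s, (β x • pexp m n s C x) (Sum.inr (Sum.inr y)) =
      if x = y then β x else 0 := by
    intro x
    by_cases h1 : x = y
    · subst h1; simp [pexp, hy]
    · by_cases hC : C x.1.2 <;> simp [pexp, hC, h1]
  rw [pexpSum, Finsupp.finsetSum_apply]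
  simp_rw [h]
  simp

/-- the fibre of an antichain exponent: it is the unique minimum of the weight. -/
lemma fiber_min (β₀ β : (Fin m × Fin n) × Fin s →₀ ℕ)
    (hL : pexpSum m n s C β = pexpSum m n s C β₀)
    (hanti : ∀ k x y, C x.2 → C y.2 → β₀ (x, k) ≠ 0 → β₀ (y, k) ≠ 0 → x.1 < y.1 → ¬ x.2 < y.2)
    (hw : Finsupp.weight (cellWt ∘ Prod.fst) β ≤ Finsupp.weight (cellWt ∘ Prod.fst) β₀) :
    β = β₀ := by
  classical
  have hout : ∀ x k, ¬ C x.2 → β (x, k) = β₀ (x, k) := by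
    intro x k hx
    have := DFunLike.congr_fun hL (Sum.inr (Sum.inr (x, k)))
    rwa [pexpSum_out m n s C _ _ hx, pexpSum_out m n s C _ _ hx] at this
  set res : ((Fin m × Fin n) × Fin s →₀ ℕ) → Fin s → Fin m × Fin n → ℕ :=
    fun γ k x => if C x.2 then γ (x, k) else 0 with hres
  have hr : ∀ k i, ∑ j, res β₀ k (i, j) = ∑ j, res β k (i, j) := by
    intro k i
    have := DFunLike.congr_fun hL (Sum.inl (i, k))
    rw [pexpSum_row, pexpSum_row] at this
    exact this.symm
  have hc : ∀ k j, ∑ i, res β₀ k (i, j) = ∑ i, res β k (i, j) := by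
    intro k j
    have := DFunLike.congr_fun hL (Sum.inr (Sum.inl (k, j)))
    rw [pexpSum_col, pexpSum_col] at this
    exact this.symm
  have ha : ∀ k x y, res β₀ k x ≠ 0 → res β₀ k y ≠ 0 → x.1 < y.1 → ¬ x.2 < y.2 := by
    intro k x y hx hy
    simp only [hres, ne_eq, ite_eq_right_iff, Classical.not_imp] at hx hy
    exact hanti k x y hx.1 hy.1 hx.2 hy.2
  have hle : ∀ k, ∑ x, res β₀ k x * cellWt x ≤ ∑ x, res β k x * cellWt x := fun k =>
    antichain_min _ _ (hr k) (hc k) (ha k)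
  have hwt : ∀ γ : (Fin m × Fin n) × Fin s →₀ ℕ, Finsupp.weight (cellWt ∘ Prod.fst) γ =
      (∑ k, ∑ x, res γ k x * cellWt x) +
      ∑ k, ∑ x : Fin m × Fin n, (if C x.2 then 0 else γ (x, k)) * cellWt x := by
    intro γ
    rw [weight_fintype, Fintype.sum_prod_type_right, ← Finset.sum_add_distrib]
    refine Finset.sum_congr rfl fun k _ => ?_
    rw [← Finset.sum_add_distrib]
    refine Finset.sum_congr rfl fun x _ => ?_
    by_cases hx : C x.2 <;> simp [hres, hx]
  have hrest : (∑ k, ∑ x : Fin m × Fin n, (if C x.2 then 0 else β (x, k)) * cellWt x) =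
      ∑ k, ∑ x : Fin m × Fin n, (if C x.2 then 0 else β₀ (x, k)) * cellWt x := by
    refine Finset.sum_congr rfl fun k _ => Finset.sum_congr rfl fun x _ => ?_
    by_cases hx : C x.2 <;> simp [hx, hout]
  rw [hwt, hwt, hrest] at hw
  have heq : ∑ k, ∑ x, res β₀ k x * cellWt x = ∑ k, ∑ x, res β k x * cellWt x :=
    le_antisymm (Finset.sum_le_sum fun k _ => hle k) (by omega)
  rw [Finset.sum_eq_sum_iff_of_le fun k _ => hle k] at heq
  ext ⟨x, k⟩
  by_cases hx : C x.2
  · have := congrFun (antichain_unique _ _ (hr k) (hc k) (ha k) (heq k (Finset.mem_univ _))) x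
    simp only [hres, hx, if_true] at this
    exact this.symm
  · exact hout x k hx

lemma split_support (f : MvPolynomial (Fin m × Fin n) K) (N : ℕ)
    (hN : ∀ b ∈ f.support, Finsupp.weight cellWt b ≤ N) (β : (Fin m × Fin n) × Fin s →₀ ℕ)
    (hβ : β ∈ (splitHom K m n s f).support) : Finsupp.weight (cellWt ∘ Prod.fst) β ≤ N := by
  classical
  have hmon : ∀ b : Fin m × Fin n →₀ ℕ, ∀ q : K,
      IsWeightedHomogeneous (cellWt ∘ Prod.fst) (splitHom K m n s (monomial b q))
        (Finsupp.weight cellWt b) := by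
    intro b q
    rw [splitHom, aeval_monomial, algebraMap_eq]
    refine IsWeightedHomogeneous.C_mul ?_ q
    rw [Finsupp.weight_apply]
    refine IsWeightedHomogeneous.prod _ _ _ fun c _ => ?_
    refine IsWeightedHomogeneous.pow ?_ _
    refine IsWeightedHomogeneous.sum _ _ _ fun k _ => ?_
    exact isWeightedHomogeneous_X K (cellWt ∘ Prod.fst) (c, k)
  rw [f.as_sum, map_sum] at hβ
  obtain ⟨b, hb, hb'⟩ := Finset.mem_biUnion.1 (support_sum hβ)
  have := hmon b (coeff b f) (mem_support_iff.1 hb')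
  rw [this]
  exact hN b hb

lemma coeff_killCompl {σ τ : Type*} {e : σ → τ} (he : Function.Injective e)
    (g : MvPolynomial τ K) (a : σ →₀ ℕ) :
    coeff a (killCompl he g) = coeff (a.mapDomain e) g := by
  classical
  induction g using MvPolynomial.induction_on' with
  | monomial u q =>
    rw [killCompl_monomial]
    split_ifs with h
    · rw [coeff_monomial, coeff_monomial]
      congr 1
      rw [eq_iff_iff]
      constructor
      · rintro rfl; exact (Finsupp.mapDomain_comapDomain e he u h).symm
      · rintro rfl; exact Finsupp.comapDomain_mapDomain e he a
    · rw [coeff_monomial, if_neg, coeff_zero]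
      rintro rfl
      apply h
      intro x hx
      have := Finsupp.mapDomain_support hx
      simp at this
      obtain ⟨y, -, rfl⟩ := this
      exact ⟨y, rfl⟩
  | add p q hp hq => simp [hp, hq]

lemma split_coeff (f : MvPolynomial (Fin m × Fin n) K) (κ : Fin m × Fin n → Fin s)
    (a : Fin m × Fin n →₀ ℕ) :
    coeff (a.mapDomain fun c => (c, κ c)) (splitHom K m n s f) = coeff a f := by
  classical
  have he : Function.Injective (fun c : Fin m × Fin n => (c, κ c)) :=
    fun x y h => (Prod.ext_iff.1 h).1
  rw [← coeff_killCompl K he]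
  congr 1
  have : (killCompl he).comp (splitHom K m n s) = AlgHom.id K _ := by
    refine algHom_ext fun c => ?_
    simp only [AlgHom.comp_apply, splitHom, aeval_X, map_sum, AlgHom.id_apply]
    rw [Finset.sum_eq_single (κ c)]
    · have := killCompl_rename_app he (X c : MvPolynomial _ K)
      rwa [rename_X] at this
    · intro k _ hk
      rw [killCompl, aeval_X, dif_neg]
      rintro ⟨d, hd⟩
      simp only [Prod.mk.injEq] at hd
      obtain ⟨rfl, rfl⟩ := hd
      exact hk rfl
    · simp
  exact AlgHom.congr_fun this f

/-- The leading-term statement: an element of the kernel of the parametrization. -/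
lemma leading_of_ker [NeZero s] (f : MvPolynomial (Fin m × Fin n) K)
    (hf : toricHom K m n s C (splitHom K m n s f) = 0) (a : Fin m × Fin n →₀ ℕ)
    (ha : a ∈ f.support)
    (hmax : ∀ b ∈ f.support, Finsupp.weight cellWt b ≤ Finsupp.weight cellWt a) :
    ∃ (r : Fin (s + 1) → Fin m) (c : Fin (s + 1) → Fin n), StrictMono r ∧ StrictMono c ∧
      (∀ i, C (c i)) ∧ ∀ i, a (r i, c i) ≠ 0 := by
  classical
  by_contra hcon
  obtain ⟨κ', h1, h2⟩ := exists_coloring s (a.support.filter fun x => C x.2) (by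
    rintro ⟨r, c, hr, hc, h⟩
    refine hcon ⟨r, c, hr, hc, fun i => ?_, fun i => ?_⟩
    · exact (Finset.mem_filter.1 (h i)).2
    · exact Finsupp.mem_support_iff.1 (Finset.mem_filter.1 (h i)).1)
  set κ : Fin m × Fin n → Fin s := fun x => Fin.ofNat s (κ' x) with hκ
  have hκ' : ∀ x ∈ a.support.filter fun x => C x.2, (κ x).val = κ' x := by
    intro x hx
    simp [hκ, Nat.mod_eq_of_lt (h1 x hx)]
  have he : Function.Injective (fun c : Fin m × Fin n => (c, κ c)) :=
    fun x y h => (Prod.ext_iff.1 h).1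
  set β₀ := a.mapDomain fun c => (c, κ c) with hβ₀
  have hβ₀s : ∀ x k, β₀ (x, k) ≠ 0 → a x ≠ 0 ∧ κ x = k := by
    intro x k h
    have := Finsupp.mapDomain_support (Finsupp.mem_support_iff.2 h)
    simp only [Finset.mem_image, Prod.mk.injEq] at this
    obtain ⟨y, hy, rfl, hk⟩ := this
    exact ⟨Finsupp.mem_support_iff.1 hy, hk⟩
  have hwβ₀ : Finsupp.weight (cellWt ∘ Prod.fst) β₀ = Finsupp.weight cellWt a := by
    rw [Finsupp.weight_apply, Finsupp.weight_apply, hβ₀,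
      Finsupp.sum_mapDomain_index (by simp) (by intros; simp [add_mul])]
    rfl
  have hanti : ∀ k x y, C x.2 → C y.2 → β₀ (x, k) ≠ 0 → β₀ (y, k) ≠ 0 →
      x.1 < y.1 → ¬ x.2 < y.2 := by
    intro k x y hx hy hx0 hy0 hlt1 hlt2
    obtain ⟨ax, kx⟩ := hβ₀s _ _ hx0
    obtain ⟨ay, ky⟩ := hβ₀s _ _ hy0
    have mx : x ∈ a.support.filter fun x => C x.2 := by simp [ax, hx]
    have my : y ∈ a.support.filter fun x => C x.2 := by simp [ay, hy]
    apply h2 x mx y my hlt1 hlt2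
    rw [← hκ' x mx, ← hκ' y my, kx, ky]
  have hco : coeff (pexpSum m n s C β₀) (toricHom K m n s C (splitHom K m n s f)) =
      coeff β₀ (splitHom K m n s f) := by
    conv_lhs => rw [(splitHom K m n s f).as_sum, map_sum]
    rw [coeff_sum]
    simp only [toricHom_monomial, coeff_monomial]
    rw [Finset.sum_eq_single β₀]
    · simp
    · intro β hβ hne
      rw [if_neg]
      intro hL
      apply hne
      refine fiber_min m n s C β₀ β hL hanti ?_
      rw [hwβ₀]
      exact split_support K m n s f _ hmax β hβ
    · intro h
      simpa using h
  rw [hf, coeff_zero, hβ₀, split_coeff] at hco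
  exact (mem_support_iff.1 ha) hco.symm

end Param

/-- Diagonal divisibility of top-weight monomials of elements of determinantal ideals. -/
lemma genMinors_leading (K : Type*) [Field K] (m n s c1 c2 : ℕ)
    (f : MvPolynomial (Fin m × Fin n) K) (hf : f ∈ genMinors K m n (s + 1) 1 m c1 c2)
    (a : Fin m × Fin n →₀ ℕ) (ha : a ∈ f.support)
    (hmax : ∀ b ∈ f.support, Finsupp.weight cellWt b ≤ Finsupp.weight cellWt a) :
    ∃ (r : Fin (s + 1) → Fin m) (c : Fin (s + 1) → Fin n), StrictMono r ∧ StrictMono c ∧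
      (∀ i, c1 ≤ (c i).val + 1 ∧ (c i).val + 1 ≤ c2) ∧ ∀ i, a (r i, c i) ≠ 0 := by
  rcases Nat.eq_zero_or_pos s with rfl | hs
  · have hle : genMinors K m n (0 + 1) 1 m c1 c2 ≤
        Ideal.span (X '' {x : Fin m × Fin n | c1 ≤ x.2.val + 1 ∧ x.2.val + 1 ≤ c2}) := by
      refine Ideal.span_le.2 ?_
      rintro p ⟨r, c, -, -, -, hc, rfl⟩
      have : Matrix.det (Matrix.of fun i j => (X (r i, c j) : MvPolynomial (Fin m × Fin n) K))
          = X (r 0, c 0) := by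
        exact Matrix.det_fin_one _
      rw [this]
      exact Ideal.subset_span ⟨_, hc 0, rfl⟩
    obtain ⟨x, hx, hax⟩ := mem_ideal_span_X_image.1 (hle hf) a ha
    exact ⟨fun _ => x.1, fun _ => x.2, fun i j hij => by rw [Fin.lt_def] at hij; omega,
      fun i j hij => by rw [Fin.lt_def] at hij; omega, fun _ => hx, fun _ => hax⟩
  · have : NeZero s := ⟨hs.ne'⟩
    refine leading_of_ker K m n s (fun j => c1 ≤ j.val + 1 ∧ j.val + 1 ≤ c2) f ?_ a ha hmax
    have hle : genMinors K m n (s + 1) 1 m c1 c2 ≤ RingHom.ker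
        ((toricHom K m n s (fun j => c1 ≤ j.val + 1 ∧ j.val + 1 ≤ c2)).comp
          (splitHom K m n s)) := by
      refine Ideal.span_le.2 ?_
      rintro p ⟨r, c, -, -, -, hc, rfl⟩
      exact toric_kills_minor K m n s _ r c hc
    exact hle hf

lemma easy_left (K : Type*) [Field K] (m n s : ℕ) :
    genMinors K m n (s + 1) 1 m 1 (n - 1) ≤ genMinors K m n s 1 m 2 (n - 1) := by
  refine Ideal.span_le.2 ?_
  rintro p ⟨r, c, hr, hc, hr', hc', rfl⟩
  rw [Matrix.det_succ_column_zero]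
  refine Ideal.sum_mem _ fun i _ => Ideal.mul_mem_left _ _ (Ideal.subset_span ?_)
  refine ⟨r ∘ i.succAbove, c ∘ Fin.succ, hr.comp (Fin.strictMono_succAbove i),
    hc.comp (Fin.strictMono_succ), fun i => hr' _, fun j => ⟨?_, (hc' _).2⟩, rfl⟩
  have : c 0 < c j.succ := hc (Fin.succ_pos j)
  rw [Fin.lt_def] at this
  simp only [Function.comp]
  omega

lemma easy_right (K : Type*) [Field K] (m n s : ℕ) :
    genMinors K m n (s + 1) 1 m 2 n ≤ genMinors K m n s 1 m 2 (n - 1) := by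
  refine Ideal.span_le.2 ?_
  rintro p ⟨r, c, hr, hc, hr', hc', rfl⟩
  rw [Matrix.det_succ_column _ (Fin.last s)]
  refine Ideal.sum_mem _ fun i _ => Ideal.mul_mem_left _ _ (Ideal.subset_span ?_)
  refine ⟨r ∘ i.succAbove, c ∘ (Fin.last s).succAbove, hr.comp (Fin.strictMono_succAbove i),
    hc.comp (Fin.strictMono_succAbove _), fun i => hr' _, fun j => ⟨(hc' _).1, ?_⟩, rfl⟩
  have : c ((Fin.last s).succAbove j) < c (Fin.last s) := hc (by
    rw [Fin.succAbove_last]; exact Fin.castSucc_lt_last j)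
  have h2 := (c (Fin.last s)).isLt
  rw [Fin.lt_def] at this
  simp only [Function.comp]
  omega

lemma genMinors_mono (K : Type*) [Field K] (m n t c1 c2 d1 d2 : ℕ) (h1 : d1 ≤ c1) (h2 : c2 ≤ d2) :
    genMinors K m n t 1 m c1 c2 ≤ genMinors K m n t 1 m d1 d2 := by
  refine Ideal.span_mono ?_
  rintro p ⟨r, c, hr, hc, hr', hc', rfl⟩
  exact ⟨r, c, hr, hc, hr', fun j => ⟨h1.trans (hc' j).1, (hc' j).2.trans h2⟩, rfl⟩

lemma hard_aux (K : Type*) [Field K] (m n s : ℕ) (hs : 0 < s) (N : ℕ) :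
    ∀ f : MvPolynomial (Fin m × Fin n) K,
      f ∈ genMinors K m n (s + 1) 1 m 1 n → f ∈ genMinors K m n s 1 m 2 (n - 1) →
      (∀ b ∈ f.support, Finsupp.weight cellWt b < N) →
      f ∈ genMinors K m n (s + 1) 1 m 1 (n - 1) ⊔ genMinors K m n (s + 1) 1 m 2 n := by
  classical
  induction N with
  | zero =>
    intro f _ _ h
    have : f = 0 := by
      rw [← support_eq_empty]
      exact Finset.eq_empty_of_forall_notMem fun b hb => absurd (h b hb) (Nat.not_lt_zero _)
    rw [this]; exact Ideal.zero_mem _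
  | succ N ih =>
    intro f hf1 hf2 hN
    have hstep : ∀ a ∈ f.support, ∃ g ∈ genMinors K m n (s + 1) 1 m 1 (n - 1) ⊔
        genMinors K m n (s + 1) 1 m 2 n, monomial a (coeff a f) - g ∈
          restrictSupport K {b : Fin m × Fin n →₀ ℕ | Finsupp.weight cellWt b < N} := by
      intro a ha
      by_cases haN : Finsupp.weight cellWt a < N
      · exact ⟨0, Ideal.zero_mem _, by
          rw [sub_zero, monomial_mem_restrictSupport]; exact Or.inl haN⟩
      have haN' : Finsupp.weight cellWt a = N := by
        have := hN a ha; omega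
      have hmax : ∀ b ∈ f.support, Finsupp.weight cellWt b ≤ Finsupp.weight cellWt a := by
        intro b hb
        have := hN b hb; omega
      obtain ⟨dr, dc, hdr, hdc, -, hD⟩ := genMinors_leading K m n s 1 n f hf1 a ha hmax
      obtain ⟨s', rfl⟩ := Nat.exists_eq_succ_of_ne_zero hs.ne'
      obtain ⟨er, ec, her, hec, hcol, hE⟩ := genMinors_leading K m n s' 2 (n - 1) f hf2 a ha hmax
      obtain ⟨r, c, hr, hc, hS, hor⟩ := crossing (s' + 1) hs {x | a x ≠ 0} dr dc er ec hdr hdc her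
        hec hD hE (fun i => by have := hcol i; omega) (fun i => by have := hcol i; omega)
      obtain ⟨h, hh⟩ := minor_reduce r c hr hc a hS (coeff a f)
      rw [haN'] at hh
      refine ⟨_, Ideal.mul_mem_left _ h ?_, hh⟩
      rcases hor with hor | hor
      · refine Ideal.mem_sup_right (Ideal.subset_span ⟨r, c, hr, hc, fun i => ?_, fun j => ?_, rfl⟩)
        · have := (r i).isLt; omega
        · have := hor j; have := (c j).isLt; omega
      · refine Ideal.mem_sup_left (Ideal.subset_span ⟨r, c, hr, hc, fun i => ?_, fun j => ?_, rfl⟩)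
        · have := (r i).isLt; omega
        · have := hor j; omega
    choose! g hg hg' using hstep
    have hG : ∑ a ∈ f.support, g a ∈ genMinors K m n (s + 1) 1 m 1 (n - 1) ⊔
        genMinors K m n (s + 1) 1 m 2 n := Ideal.sum_mem _ hg
    have hG1 := (sup_le (genMinors_mono K m n (s + 1) 1 (n - 1) 1 n le_rfl (Nat.sub_le _ _))
      (genMinors_mono K m n (s + 1) 2 n 1 n (by omega) le_rfl)) hG
    have hG2 := (sup_le (easy_left K m n s) (easy_right K m n s)) hG
    have hdiff : f - ∑ a ∈ f.support, g a ∈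
        restrictSupport K {b : Fin m × Fin n →₀ ℕ | Finsupp.weight cellWt b < N} := by
      nth_rewrite 1 [f.as_sum]
      rw [← Finset.sum_sub_distrib]
      exact Submodule.sum_mem _ hg'
    have := ih _ (Ideal.sub_mem _ hf1 hG1) (Ideal.sub_mem _ hf2 hG2)
      (fun b hb => ((mem_restrictSupport_iff K).1 hdiff) hb)
    have h2 := Ideal.add_mem _ this hG
    rwa [sub_add_cancel] at h2

/-- `I_t(X_{[1,n-1]}) + I_t(X_{[2,n]}) = I_t(X_{[1,n]}) ∩ I_{t-1}(X_{[2,n-1]})`. -/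
theorem sum_adjacent_minors_last_step (K : Type*) [Field K] (m n : ℕ)
    (hm : 0 < m) (hmn : m ≤ n) (t : ℕ) (ht2 : 2 ≤ t) (htm : t ≤ m) (htn : t ≤ n - 2) :
    genMinors K m n t 1 m 1 (n - 1) + genMinors K m n t 1 m 2 n
      = genMinors K m n t 1 m 1 n ⊓ genMinors K m n (t - 1) 1 m 2 (n - 1) := by
  obtain ⟨s, rfl⟩ : ∃ s, t = s + 1 := ⟨t - 1, by omega⟩
  rw [Nat.add_sub_cancel]
  refine le_antisymm ?_ ?_
  · refine sup_le (le_inf ?_ (easy_left K m n s)) (le_inf ?_ (easy_right K m n s))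
    · exact genMinors_mono K m n (s + 1) 1 (n - 1) 1 n le_rfl (Nat.sub_le _ _)
    · exact genMinors_mono K m n (s + 1) 2 n 1 n (by omega) le_rfl
  · rintro f ⟨hf1, hf2⟩
    refine hard_aux K m n s (by omega) (f.support.sup (Finsupp.weight cellWt) + 1) f hf1 hf2 ?_
    intro b hb
    exact Nat.lt_succ_of_le (Finset.le_sup (f := Finsupp.weight cellWt) hb)
end
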